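/- arXiv:2409.04994 — 11 statements merged into one kernel-verified Lean document; each statement's English description precedes it below -/
import Mathlib

section
/- Let X ∈ ℝ^{m×n} be nonnegative and suppose X has an exact nonnegative factorization X = U₀V₀ᵀ, where U₀ ∈ ℝ^{m×r} and V₀ ∈ ℝ^{n×r} are nonnegative and both have rank r, with r ≤ min{m,n}. Let A₁ ∈ ℝ^{r×m} and A₂ ∈ ℝ^{n×r} be matrices such that the r×r matrix A₁XA₂ is invertible (then (XA₂)ᵀ(XA₂) and (A₁X)(A₁X)ᵀ are invertible, so the orthogonal projections P₁ = XA₂((XA₂)ᵀXA₂)⁻¹(XA₂)ᵀ onto the column space of XA₂ and P₂ = (A₁X)ᵀ(A₁X(A₁X)ᵀ)⁻¹A₁X onto the row space of A₁X are well defined). Fix λ₁, λ₂ > 0 and for nonnegative U ∈ ℝ^{m×r}, V ∈ ℝ^{n×r} set f(U,V) = ‖A₁(X−UVᵀ)‖_F² + ‖(X−UVᵀ)A₂‖_F² + λ₁‖(I_m − P₁)UVᵀ‖_F² + λ₂‖UVᵀ(I_n − P₂)‖_F². If Ũ ∈ ℝ^{m×r} and Ṽ ∈ ℝ^{n×r}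 are nonnegative and satisfy f(Ũ,Ṽ) ≤ f(U,V) for all nonnegative U ∈ ℝ^{m×r}, V ∈ ℝ^{n×r}, then X = ŨṼᵀ. -/
open Matrix

/-- Squared Frobenius norm of a real matrix. -/
noncomputable def frobSq {m n : ℕ} (M : Matrix (Fin m) (Fin n) ℝ) : ℝ :=
  ∑ i, ∑ j, (M i j) ^ 2

theorem frobSq_nonneg {m n : ℕ} (M : Matrix (Fin m) (Fin n) ℝ) : 0 ≤ frobSq M :=
  Finset.sum_nonneg fun _ _ => Finset.sum_nonneg fun _ _ => sq_nonneg _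

theorem frobSq_zero {m n : ℕ} : frobSq (0 : Matrix (Fin m) (Fin n) ℝ) = 0 := by
  simp [frobSq]

theorem eq_zero_of_frobSq_eq_zero {m n : ℕ} {M : Matrix (Fin m) (Fin n) ℝ}
    (h : frobSq M = 0) : M = 0 := by
  ext i j
  have hrow := (Finset.sum_eq_zero_iff_of_nonneg fun i _ =>
    Finset.sum_nonneg fun j _ => sq_nonneg (M i j)).1 h i (Finset.mem_univ i)
  have hent := (Finset.sum_eq_zero_iff_of_nonneg fun j _ => sq_nonneg (M i j)).1 hrow j
    (Finset.mem_univ j)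
  simpa using hent

/-- The Gram matrix of a real matrix with a left inverse is invertible. -/
theorem isUnit_det_transpose_mul_self {m r : ℕ} {W : Matrix (Fin m) (Fin r) ℝ}
    {L : Matrix (Fin r) (Fin m) ℝ} (h : L * W = 1) : IsUnit (Wᵀ * W).det := by
  have hinj : Function.Injective W.mulVec := by
    intro u v huv
    have := congrArg L.mulVec huv
    simpa [Matrix.mulVec_mulVec, h] using this
  have hpos := Matrix.PosDef.conjTranspose_mul_self W hinj
  rw [Matrix.conjTranspose_eq_transpose_of_trivial] at hpos
  exact hpos.det_pos.ne'.isUnit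

/-- Exact recovery of a nonnegative factorization from two-sided compressed
measurements (Theorem: two-sided compression). -/
theorem two_sided_exact_recovery
    {m n r : ℕ} (hrm : r ≤ m) (hrn : r ≤ n)
    (X : Matrix (Fin m) (Fin n) ℝ) (hX : ∀ i j, 0 ≤ X i j)
    (U₀ : Matrix (Fin m) (Fin r) ℝ) (V₀ : Matrix (Fin n) (Fin r) ℝ)
    (hU₀ : ∀ i j, 0 ≤ U₀ i j) (hV₀ : ∀ i j, 0 ≤ V₀ i j)
    (hU₀rank : U₀.rank = r) (hV₀rank : V₀.rank = r)
    (hfact : X = U₀ * V₀ᵀ)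
    (A₁ : Matrix (Fin r) (Fin m) ℝ) (A₂ : Matrix (Fin n) (Fin r) ℝ)
    (hinv : IsUnit (A₁ * X * A₂))
    (lam₁ lam₂ : ℝ) (hlam₁ : 0 < lam₁) (hlam₂ : 0 < lam₂)
    -- the orthogonal projections onto the column space of X*A₂ and the
    -- row space of A₁*X
    (P₁ : Matrix (Fin m) (Fin m) ℝ) (P₂ : Matrix (Fin n) (Fin n) ℝ)
    (hP₁ : P₁ = X * A₂ * ((X * A₂)ᵀ * (X * A₂))⁻¹ * (X * A₂)ᵀ)
    (hP₂ : P₂ = (A₁ * X)ᵀ * (A₁ * X * (A₁ * X)ᵀ)⁻¹ * (A₁ * X))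
    -- the compressed objective function
    (f : Matrix (Fin m) (Fin r) ℝ → Matrix (Fin n) (Fin r) ℝ → ℝ)
    (hf : ∀ U V, f U V =
      frobSq (A₁ * (X - U * Vᵀ)) + frobSq ((X - U * Vᵀ) * A₂)
        + lam₁ * frobSq ((1 - P₁) * (U * Vᵀ))
        + lam₂ * frobSq ((U * Vᵀ) * (1 - P₂)))
    (Uopt : Matrix (Fin m) (Fin r) ℝ) (Vopt : Matrix (Fin n) (Fin r) ℝ)
    (hUopt : ∀ i j, 0 ≤ Uopt i j) (hVopt : ∀ i j, 0 ≤ Vopt i j)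
    (hopt : ∀ U V, (∀ i j, 0 ≤ U i j) → (∀ i j, 0 ≤ V i j) → f Uopt Vopt ≤ f U V) :
    X = Uopt * Voptᵀ := by
  have hM : A₁ * X * A₂ = (A₁ * U₀) * (V₀ᵀ * A₂) := by
    rw [hfact]; simp only [Matrix.mul_assoc]
  have hMdet : IsUnit (A₁ * X * A₂).det := (Matrix.isUnit_iff_isUnit_det _).1 hinv
  have hdet : IsUnit ((A₁ * U₀).det * (V₀ᵀ * A₂).det) := by
    rwa [hM, Matrix.det_mul] at hMdet
  obtain ⟨hB, hC⟩ := IsUnit.mul_iff.1 hdet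
  have hcol : X = (X * A₂) * ((V₀ᵀ * A₂)⁻¹ * V₀ᵀ) := by
    have : X * A₂ = U₀ * (V₀ᵀ * A₂) := by rw [hfact, Matrix.mul_assoc]
    rw [this, Matrix.mul_assoc, Matrix.mul_nonsing_inv_cancel_left _ _ hC, hfact]
  have hrow : X = (U₀ * (A₁ * U₀)⁻¹) * (A₁ * X) := by
    have : A₁ * X = (A₁ * U₀) * V₀ᵀ := by rw [hfact, Matrix.mul_assoc]
    rw [this, Matrix.mul_assoc, Matrix.nonsing_inv_mul_cancel_left _ _ hB, hfact]
  have hgram₁ : IsUnit ((X * A₂)ᵀ * (X * A₂)).det :=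
    isUnit_det_transpose_mul_self (L := (A₁ * X * A₂)⁻¹ * A₁) (by
      rw [Matrix.mul_assoc, ← Matrix.mul_assoc A₁ X A₂, Matrix.nonsing_inv_mul _ hMdet])
  have hgram₂ : IsUnit (A₁ * X * (A₁ * X)ᵀ).det := by
    have := isUnit_det_transpose_mul_self (W := (A₁ * X)ᵀ)
      (L := (A₂ * (A₁ * X * A₂)⁻¹)ᵀ) (by
        rw [← Matrix.transpose_mul, ← Matrix.mul_assoc, Matrix.mul_nonsing_inv _ hMdet,
          Matrix.transpose_one])
    rwa [Matrix.transpose_transpose] at this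
  have hP₁X : P₁ * X = X := by
    have hW : P₁ * (X * A₂) = X * A₂ := by
      rw [hP₁, Matrix.mul_assoc, Matrix.mul_assoc, Matrix.nonsing_inv_mul _ hgram₁,
        Matrix.mul_one]
    conv_lhs => rw [hcol]
    rw [← Matrix.mul_assoc, hW, ← hcol]
  have hXP₂ : X * P₂ = X := by
    have hN : (A₁ * X) * P₂ = A₁ * X := by
      rw [hP₂, ← Matrix.mul_assoc (A₁ * X) _ (A₁ * X), ← Matrix.mul_assoc (A₁ * X) (A₁ * X)ᵀ,
        Matrix.mul_nonsing_inv _ hgram₂,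
        Matrix.one_mul]
    conv_lhs => rw [hrow]
    rw [Matrix.mul_assoc, hN, ← hrow]
  have hzero : f U₀ V₀ = 0 := by
    rw [hf, ← hfact]
    simp [Matrix.sub_mul, Matrix.mul_sub, hP₁X, hXP₂, frobSq_zero]
  have hle : f Uopt Vopt ≤ 0 := hzero ▸ hopt U₀ V₀ hU₀ hV₀
  rw [hf] at hle
  set Y := Uopt * Voptᵀ
  have h₁ := frobSq_nonneg (A₁ * (X - Y))
  have h₂ := frobSq_nonneg ((X - Y) * A₂)
  have h₃ := mul_nonneg hlam₁.le (frobSq_nonneg ((1 - P₁) * Y))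
  have h₄ := mul_nonneg hlam₂.le (frobSq_nonneg (Y * (1 - P₂)))
  have hA₁ : A₁ * (X - Y) = 0 := eq_zero_of_frobSq_eq_zero (by linarith)
  have hY : (1 - P₁) * Y = 0 := by
    have : lam₁ * frobSq ((1 - P₁) * Y) = 0 := by linarith
    exact eq_zero_of_frobSq_eq_zero ((mul_eq_zero.1 this).resolve_left hlam₁.ne')
  have hP₁Y : P₁ * Y = Y := by
    rw [Matrix.sub_mul, Matrix.one_mul, sub_eq_zero] at hY
    exact hY.symm
  obtain ⟨G, hG⟩ : ∃ G, X - Y = X * A₂ * G :=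
    ⟨((X * A₂)ᵀ * (X * A₂))⁻¹ * (X * A₂)ᵀ * (X - Y), by
      rw [← Matrix.mul_assoc, ← Matrix.mul_assoc, ← hP₁, Matrix.mul_sub, hP₁X, hP₁Y]⟩
  have hMG : A₁ * X * A₂ * G = 0 := by
    rw [← hA₁, hG]; simp only [Matrix.mul_assoc]
  have hG₀ : G = 0 := by
    rw [← Matrix.nonsing_inv_mul_cancel_left _ G hMdet, hMG, Matrix.mul_zero]
  rw [hG₀, Matrix.mul_zero, sub_eq_zero] at hG
  exact hG
end

section
/- Let X ∈ ℝ^{m×n} be nonnegative and let A ∈ ℝ^{k×m} satisfy AAᵀ = I_k (orthonormal rows), and write P_A = AᵀA and P_A^⊥ = I_m − AᵀA. Let U₀ ∈ ℝ^{m×r} and V₀ ∈ ℝ^{n×r} be any nonnegative matrices and set X₀ = U₀V₀ᵀ. Fix λ > 0 and for nonnegative U ∈ ℝ^{m×r}, V ∈ ℝ^{n×r} set f(U,V) = ‖A(X−UVᵀ)‖_F² + λ‖P_A^⊥ UVᵀ‖_F². If Ũ, Ṽ are nonnegative and satisfy f(Ũ,Ṽ) ≤ f(U,V) for all nonnegative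 U ∈ ℝ^{m×r}, V ∈ ℝ^{n×r}, then X̃ := ŨṼᵀ satisfies ‖X − X̃‖_F² ≤ c_λ · ( ‖X − X₀‖_F² + ‖P_A^⊥ X‖_F² ), where c_λ = max(2/λ, 6, 2λ + 2). -/
open Matrix

theorem frobSq_eq_trace {m n : ℕ} (M : Matrix (Fin m) (Fin n) ℝ) :
    frobSq M = (Mᵀ * M).trace := by
  simp only [frobSq, trace, diag, mul_apply, transpose_apply, pow_two]
  exact Finset.sum_comm

theorem frobSq_sub_le {m n : ℕ} (M N : Matrix (Fin m) (Fin n) ℝ) :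
    frobSq (M - N) ≤ 2 * frobSq M + 2 * frobSq N := by
  simp only [frobSq, Finset.mul_sum, ← Finset.sum_add_distrib, Matrix.sub_apply]
  gcongr with i _ j _
  nlinarith [sq_nonneg (M i j + N i j)]

/-- Pythagoras for the row space of a matrix with orthonormal rows. -/
theorem frobSq_mul_add_frobSq_compl_mul {k m n : ℕ} {A : Matrix (Fin k) (Fin m) ℝ}
    (hA : A * Aᵀ = 1) (M : Matrix (Fin m) (Fin n) ℝ) :
    frobSq (A * M) + frobSq ((1 - Aᵀ * A) * M) = frobSq M := by
  have hP : Aᵀ * A * (Aᵀ * A) = Aᵀ * A := by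
    rw [Matrix.mul_assoc, ← Matrix.mul_assoc A, hA, Matrix.one_mul]
  have hQ : (1 - Aᵀ * A)ᵀ * (1 - Aᵀ * A) = 1 - Aᵀ * A := by
    rw [transpose_sub, transpose_one, transpose_mul, transpose_transpose, Matrix.mul_sub,
      Matrix.sub_mul, Matrix.sub_mul, Matrix.one_mul, Matrix.one_mul, Matrix.mul_one, hP]
    simp
  have h₁ : (A * M)ᵀ * (A * M) = Mᵀ * (Aᵀ * A * M) := by
    simp only [transpose_mul, Matrix.mul_assoc]
  have h₂ : ((1 - Aᵀ * A) * M)ᵀ * ((1 - Aᵀ * A) * M) = Mᵀ * ((1 - Aᵀ * A) * M) := by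
    rw [transpose_mul, Matrix.mul_assoc, ← Matrix.mul_assoc _ _ M, hQ]
  rw [frobSq_eq_trace, frobSq_eq_trace, frobSq_eq_trace, h₁, h₂, ← trace_add,
    ← Matrix.mul_add, ← Matrix.add_mul, add_sub_cancel, Matrix.one_mul]

/-- Error bound for one-sided compressed NMF with a sketching matrix having
orthonormal rows (Theorem: orthogonal A). -/
theorem one_sided_orthogonal_error
    {m n r k : ℕ}
    (X : Matrix (Fin m) (Fin n) ℝ) (hX : ∀ i j, 0 ≤ X i j)
    (A : Matrix (Fin k) (Fin m) ℝ) (hA : A * Aᵀ = 1)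
    (U₀ : Matrix (Fin m) (Fin r) ℝ) (V₀ : Matrix (Fin n) (Fin r) ℝ)
    (hU₀ : ∀ i j, 0 ≤ U₀ i j) (hV₀ : ∀ i j, 0 ≤ V₀ i j)
    (lam : ℝ) (hlam : 0 < lam)
    (f : Matrix (Fin m) (Fin r) ℝ → Matrix (Fin n) (Fin r) ℝ → ℝ)
    (hf : ∀ U V, f U V =
      frobSq (A * (X - U * Vᵀ)) + lam * frobSq ((1 - Aᵀ * A) * (U * Vᵀ)))
    (Uopt : Matrix (Fin m) (Fin r) ℝ) (Vopt : Matrix (Fin n) (Fin r) ℝ)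
    (hUopt : ∀ i j, 0 ≤ Uopt i j) (hVopt : ∀ i j, 0 ≤ Vopt i j)
    (hopt : ∀ U V, (∀ i j, 0 ≤ U i j) → (∀ i j, 0 ≤ V i j) →
      f Uopt Vopt ≤ f U V) :
    frobSq (X - Uopt * Voptᵀ) ≤
      max (2 / lam) (max 6 (2 * lam + 2)) *
        (frobSq (X - U₀ * V₀ᵀ) + frobSq ((1 - Aᵀ * A) * X)) := by
  have hmin := hopt U₀ V₀ hU₀ hV₀
  rw [hf, hf] at hmin
  have hX₀ : frobSq ((1 - Aᵀ * A) * (U₀ * V₀ᵀ)) ≤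
      2 * frobSq ((1 - Aᵀ * A) * X) + 2 * frobSq ((1 - Aᵀ * A) * (X - U₀ * V₀ᵀ)) := by
    have := frobSq_sub_le ((1 - Aᵀ * A) * X) ((1 - Aᵀ * A) * (X - U₀ * V₀ᵀ))
    rwa [← Matrix.mul_sub, sub_sub_cancel] at this
  have hXopt := frobSq_sub_le ((1 - Aᵀ * A) * X) ((1 - Aᵀ * A) * (Uopt * Voptᵀ))
  rw [← Matrix.mul_sub] at hXopt
  rw [← frobSq_mul_add_frobSq_compl_mul hA (X - Uopt * Voptᵀ),
    ← frobSq_mul_add_frobSq_compl_mul hA (X - U₀ * V₀ᵀ)]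
  clear hf hopt
  have ha := frobSq_nonneg (A * (X - Uopt * Voptᵀ))
  have hb := frobSq_nonneg ((1 - Aᵀ * A) * (Uopt * Voptᵀ))
  have ha₀ := frobSq_nonneg (A * (X - U₀ * V₀ᵀ))
  have hd₀ := frobSq_nonneg ((1 - Aᵀ * A) * (X - U₀ * V₀ᵀ))
  have hq := frobSq_nonneg ((1 - Aᵀ * A) * X)
  generalize frobSq (A * (X - Uopt * Voptᵀ)) = a at *
  generalize frobSq ((1 - Aᵀ * A) * (X - Uopt * Voptᵀ)) = d at *
  generalize frobSq ((1 - Aᵀ * A) * (Uopt * Voptᵀ)) = b at *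
  generalize frobSq (A * (X - U₀ * V₀ᵀ)) = a₀ at *
  generalize frobSq ((1 - Aᵀ * A) * (X - U₀ * V₀ᵀ)) = d₀ at *
  generalize frobSq ((1 - Aᵀ * A) * (U₀ * V₀ᵀ)) = b₀ at *
  generalize frobSq ((1 - Aᵀ * A) * X) = q at *
  have hmin' : a + lam * b ≤ a₀ + lam * (2 * q + 2 * d₀) := hmin.trans (by gcongr)
  have hc₁ : 2 / lam ≤ max (2 / lam) (max 6 (2 * lam + 2)) := le_max_left _ _
  have hc₂ : 6 ≤ max (2 / lam) (max 6 (2 * lam + 2)) :=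
    (le_max_left _ _).trans (le_max_right _ _)
  have hc₃ : 2 * lam + 2 ≤ max (2 / lam) (max 6 (2 * lam + 2)) :=
    (le_max_right _ _).trans (le_max_right _ _)
  generalize max (2 / lam) (max 6 (2 * lam + 2)) = c at *
  rcases le_total 2 lam with h | h
  · have hb' : 2 * b ≤ lam * b := by gcongr
    have h₁ : (2 * lam + 2) * (a₀ + d₀ + q) ≤ c * (a₀ + d₀ + q) := by gcongr
    have h₂ : 0 ≤ lam * a₀ := by positivity
    linarith
  · have ha' : a ≤ 2 / lam * a := le_mul_of_one_le_left ha ((one_le_div hlam).2 h)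
    have hscaled : 2 / lam * a + 2 * b ≤ 2 / lam * a₀ + 4 * q + 4 * d₀ := by
      have := mul_le_mul_of_nonneg_left hmin' (by positivity : 0 ≤ 2 / lam)
      field_simp at this ⊢
      linarith
    have h₁ : 2 / lam * a₀ ≤ c * a₀ := by gcongr
    have h₂ : 6 * (d₀ + q) ≤ c * (d₀ + q) := by gcongr
    linarith
end

section
/- Let 0 < ε < 1 and let A ∈ ℝ^{k×m} be ε-approximately orthogonal, i.e. every singular value of A lies in the interval [1−ε, 1+ε] (in particular A has rank k, so AAᵀ is invertible and P_A := Aᵀ(AAᵀ)⁻¹A is the orthogonal projection onto the row space of A). Then for every matrix M ∈ ℝ^{m×n}, (1 − ε)·‖P_A M‖_F ≤ ‖A M‖_F ≤ (1 + ε)·‖P_A M‖_F. -/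
open Matrix

/-- Frobenius norm of a real matrix. -/
noncomputable def frobNorm {m n : ℕ} (M : Matrix (Fin m) (Fin n) ℝ) : ℝ :=
  Real.sqrt (frobSq M)

/-- `A` is ε-approximately orthogonal: all singular values of `A` lie in
`[1-ε, 1+ε]`.  Equivalently (for `0 ≤ 1-ε`), the Rayleigh quotient of `A*Aᵀ`
lies in `[(1-ε)², (1+ε)²]`, i.e. `(1-ε)‖y‖ ≤ ‖Aᵀy‖ ≤ (1+ε)‖y‖` for all `y`. -/
def ApproxOrthogonal {k m : ℕ} (ε : ℝ) (A : Matrix (Fin k) (Fin m) ℝ) : Prop :=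
  ∀ y : Fin k → ℝ,
    (1 - ε) ^ 2 * (∑ i, (y i) ^ 2) ≤ ∑ j, (Aᵀ.mulVec y j) ^ 2 ∧
      ∑ j, (Aᵀ.mulVec y j) ^ 2 ≤ (1 + ε) ^ 2 * (∑ i, (y i) ^ 2)

/-- The sum of squares of the coordinates of `Aᵀ y` is the quadratic form of `A Aᵀ` at `y`. -/
theorem sum_sq_transpose_mulVec {k m : ℕ} (A : Matrix (Fin k) (Fin m) ℝ) (y : Fin k → ℝ) :
    ∑ j, (Aᵀ *ᵥ y) j ^ 2 = y ⬝ᵥ (A *ᵥ (Aᵀ *ᵥ y)) := by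
  rw [dotProduct_mulVec, ← mulVec_transpose]
  simp only [dotProduct, sq]

theorem ApproxOrthogonal.isUnit_det_mul_transpose {k m : ℕ} {ε : ℝ} (hε1 : ε < 1)
    {A : Matrix (Fin k) (Fin m) ℝ} (hA : ApproxOrthogonal ε A) : IsUnit (A * Aᵀ).det := by
  rw [isUnit_iff_ne_zero]
  intro h
  obtain ⟨v, hv, hv0⟩ := exists_mulVec_eq_zero_iff.mpr h
  have h1 := (hA v).1
  rw [sum_sq_transpose_mulVec, mulVec_mulVec, hv0, dotProduct_zero] at h1
  have hε : 0 < (1 - ε) ^ 2 := pow_pos (by linarith) 2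
  have h2 : ∑ i, v i ^ 2 = 0 :=
    le_antisymm (nonpos_of_mul_nonpos_right h1 hε) (Finset.sum_nonneg fun i _ => sq_nonneg _)
  rw [Finset.sum_eq_zero_iff_of_nonneg fun i _ => sq_nonneg _] at h2
  exact hv (funext fun i => pow_eq_zero_iff two_ne_zero |>.mp (h2 i (Finset.mem_univ i)))

/-- On the row space of `A`, the map `A` distorts lengths by a factor in `[1 - ε, 1 + ε]`. -/
theorem ApproxOrthogonal.sum_sq_mulVec_transpose_mulVec {k m : ℕ} {ε : ℝ}
    {A : Matrix (Fin k) (Fin m) ℝ} (hA : ApproxOrthogonal ε A) (y : Fin k → ℝ) :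
    (1 - ε) ^ 2 * ∑ j, (Aᵀ *ᵥ y) j ^ 2 ≤ ∑ i, (A *ᵥ (Aᵀ *ᵥ y)) i ^ 2 ∧
      ∑ i, (A *ᵥ (Aᵀ *ᵥ y)) i ^ 2 ≤ (1 + ε) ^ 2 * ∑ j, (Aᵀ *ᵥ y) j ^ 2 := by
  have hy := (hA y).1
  have hb := (hA (A *ᵥ (Aᵀ *ᵥ y))).2
  have hpp := sum_sq_transpose_mulVec A y
  set p := Aᵀ *ᵥ y
  set b := A *ᵥ p with hbdef
  have hbb : ∑ i, b i ^ 2 = ∑ j, (Aᵀ *ᵥ b) j * p j := by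
    change _ = (Aᵀ *ᵥ b) ⬝ᵥ p
    rw [mulVec_transpose, ← dotProduct_mulVec, ← hbdef]
    simp only [dotProduct, sq]
  have hcs1 := Finset.sum_mul_sq_le_sq_mul_sq Finset.univ y b
  have hcs2 := Finset.sum_mul_sq_le_sq_mul_sq Finset.univ (Aᵀ *ᵥ b) p
  change (y ⬝ᵥ b) ^ 2 ≤ _ at hcs1
  rw [← hpp] at hcs1
  rw [← hbb] at hcs2
  have hP : 0 ≤ ∑ j, p j ^ 2 := Finset.sum_nonneg fun _ _ => sq_nonneg _
  have hB : 0 ≤ ∑ i, b i ^ 2 := Finset.sum_nonneg fun _ _ => sq_nonneg _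
  generalize ∑ j, p j ^ 2 = P at *
  generalize ∑ i, b i ^ 2 = B at *
  constructor
  · rcases hP.eq_or_lt with rfl | hP'
    · simpa using hB
    · refine le_of_mul_le_mul_right ?_ hP'
      have h1 := mul_le_mul_of_nonneg_left hcs1 (sq_nonneg (1 - ε))
      have h2 := mul_le_mul_of_nonneg_right hy hB
      linarith
  · rcases hB.eq_or_lt with rfl | hB'
    · positivity
    · refine le_of_mul_le_mul_right ?_ hB'
      have h2 := mul_le_mul_of_nonneg_right hb hP
      linarith

theorem frobSq_eq_sum_col {m n : ℕ} (M : Matrix (Fin m) (Fin n) ℝ) :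
    frobSq M = ∑ j, ∑ i, M i j ^ 2 :=
  Finset.sum_comm

/-- The Frobenius version of `ApproxOrthogonal.sum_sq_mulVec_transpose_mulVec`. -/
theorem ApproxOrthogonal.frobSq_mul_transpose_mul {k m n : ℕ} {ε : ℝ}
    {A : Matrix (Fin k) (Fin m) ℝ} (hA : ApproxOrthogonal ε A) (Y : Matrix (Fin k) (Fin n) ℝ) :
    (1 - ε) ^ 2 * frobSq (Aᵀ * Y) ≤ frobSq (A * (Aᵀ * Y)) ∧
      frobSq (A * (Aᵀ * Y)) ≤ (1 + ε) ^ 2 * frobSq (Aᵀ * Y) := by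
  simp only [frobSq_eq_sum_col, Finset.mul_sum (s := (Finset.univ : Finset (Fin n)))]
  exact ⟨Finset.sum_le_sum fun j _ => (hA.sum_sq_mulVec_transpose_mulVec fun i => Y i j).1,
    Finset.sum_le_sum fun j _ => (hA.sum_sq_mulVec_transpose_mulVec fun i => Y i j).2⟩

/-- For an ε-approximately orthogonal sketching matrix `A`,
`‖A M‖_F` is within factors `1∓ε` of `‖P_A M‖_F`, where
`P_A = Aᵀ(AAᵀ)⁻¹A` is the orthogonal projection onto the row space of `A`. -/
theorem approx_orthogonal_frobenius_sandwich
    {k m n : ℕ} (ε : ℝ) (hε0 : 0 < ε) (hε1 : ε < 1)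
    (A : Matrix (Fin k) (Fin m) ℝ) (hA : ApproxOrthogonal ε A)
    (M : Matrix (Fin m) (Fin n) ℝ) :
    (1 - ε) * frobNorm (Aᵀ * (A * Aᵀ)⁻¹ * A * M) ≤ frobNorm (A * M) ∧
      frobNorm (A * M) ≤ (1 + ε) * frobNorm (Aᵀ * (A * Aᵀ)⁻¹ * A * M) := by
  have hAP : A * (Aᵀ * ((A * Aᵀ)⁻¹ * A * M)) = A * M := by
    rw [← Matrix.mul_assoc, Matrix.mul_assoc (A * Aᵀ)⁻¹, ← Matrix.mul_assoc (A * Aᵀ),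
      mul_nonsing_inv _ (hA.isUnit_det_mul_transpose hε1), Matrix.one_mul]
  have hP : Aᵀ * (A * Aᵀ)⁻¹ * A * M = Aᵀ * ((A * Aᵀ)⁻¹ * A * M) := by
    simp only [Matrix.mul_assoc]
  have h := hA.frobSq_mul_transpose_mul ((A * Aᵀ)⁻¹ * A * M)
  rw [hAP, ← hP] at h
  have hsqrt {c : ℝ} (hc : 0 ≤ c) (x : ℝ) : c * √x = √(c ^ 2 * x) := by
    rw [Real.sqrt_mul (sq_nonneg c), Real.sqrt_sq hc]
  unfold frobNorm
  rw [hsqrt (by linarith), hsqrt (by linarith)]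
  exact ⟨Real.sqrt_le_sqrt h.1, Real.sqrt_le_sqrt h.2⟩
end

section
/- Let X ∈ ℝ^{m×n} be nonnegative with an exact nonnegative factorization X = U₀V₀ᵀ, where U₀ ∈ ℝ^{m×r}, V₀ ∈ ℝ^{n×r} are nonnegative and both have rank r, with r ≤ min{m,n}. Let A₁ ∈ ℝ^{r×m} and A₂ ∈ ℝ^{n×r} be such that A₁XA₂ is invertible, and let P₁ = XA₂((XA₂)ᵀXA₂)⁻¹(XA₂)ᵀ and P₂ = (A₁X)ᵀ(A₁X(A₁X)ᵀ)⁻¹A₁X be the orthogonal projections onto the column space of XA₂ and the row space of A₁X. Fix λ₁, λ₂ > 0 and σ₁, σ₂ ≥ 0 and for nonnegative U ∈ ℝ^{m×r}, V ∈ ℝ^{n×r} set g(U,V) = ‖A₁(X−UVᵀ)‖_F² + ‖(X−UVᵀ)A₂‖_F² + λ₁‖(I_m − P₁)UVᵀ‖_F² + λ₂‖UVᵀ(I_n − P₂)‖_F² + σ₁‖1_mᵀ(X−UVᵀ)‖² + σ₂‖(X−UVᵀ)1_n‖². If Ũ, Ṽ are nonnegative and satisfy g(Ũ,Ṽ) ≤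 g(U,V) for all nonnegative U ∈ ℝ^{m×r}, V ∈ ℝ^{n×r}, then X = ŨṼᵀ. -/
open Matrix

/-- The Gram matrix of a left-invertible real matrix is invertible. -/
theorem isUnit_det_gram_of_leftInverse {k r : Type*} [Fintype k] [Fintype r] [DecidableEq r]
    {K : Matrix k r ℝ} {L : Matrix r k ℝ} (h : L * K = 1) : IsUnit (Kᵀ * K).det := by
  have hinj : Function.Injective K.mulVec := fun v w hvw => by
    simpa [Matrix.mulVec_mulVec, h] using congrArg L.mulVec hvw
  have hpos := Matrix.PosDef.conjTranspose_mul_self K hinj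
  rw [Matrix.conjTranspose_eq_transpose_of_trivial] at hpos
  exact hpos.det_pos.ne'.isUnit

/-- If `X` factors through dimension `r` and `A₁ * X * A₂` is invertible, then `X` is
determined by `X * A₂` and `A₁ * X`. -/
theorem eq_mul_inv_mul_of_factorization {m n r : Type*} [Fintype m] [Fintype n] [Fintype r]
    [DecidableEq r] (U : Matrix m r ℝ) (V : Matrix n r ℝ) (A₁ : Matrix r m ℝ) (A₂ : Matrix n r ℝ)
    (h : IsUnit (A₁ * (U * Vᵀ) * A₂)) :
    (U * Vᵀ) * A₂ * (A₁ * (U * Vᵀ) * A₂)⁻¹ * (A₁ * (U * Vᵀ)) = U * Vᵀ := by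
  have hS : A₁ * (U * Vᵀ) * A₂ = (A₁ * U) * (Vᵀ * A₂) := by simp only [Matrix.mul_assoc]
  rw [hS, Matrix.isUnit_iff_isUnit_det, Matrix.det_mul, IsUnit.mul_iff] at h
  calc (U * Vᵀ) * A₂ * (A₁ * (U * Vᵀ) * A₂)⁻¹ * (A₁ * (U * Vᵀ))
      = U * ((Vᵀ * A₂) * (Vᵀ * A₂)⁻¹) * ((A₁ * U)⁻¹ * (A₁ * U)) * Vᵀ := by
        rw [hS, Matrix.mul_inv_rev]; simp only [Matrix.mul_assoc]
    _ = U * Vᵀ := by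
        rw [Matrix.mul_nonsing_inv _ h.2, Matrix.nonsing_inv_mul _ h.1, Matrix.mul_one,
          Matrix.mul_one]

/-- Exact recovery of a nonnegative factorization from two-sided compressed
measurements with additional column-sum and row-sum matching penalties
(Corollary: shifted two-sided objective). -/
theorem two_sided_exact_recovery_with_shifts
    {m n r : ℕ} (hrm : r ≤ m) (hrn : r ≤ n)
    (X : Matrix (Fin m) (Fin n) ℝ) (hX : ∀ i j, 0 ≤ X i j)
    (U₀ : Matrix (Fin m) (Fin r) ℝ) (V₀ : Matrix (Fin n) (Fin r) ℝ)
    (hU₀ : ∀ i j, 0 ≤ U₀ i j) (hV₀ : ∀ i j, 0 ≤ V₀ i j)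
    (hU₀rank : U₀.rank = r) (hV₀rank : V₀.rank = r)
    (hfact : X = U₀ * V₀ᵀ)
    (A₁ : Matrix (Fin r) (Fin m) ℝ) (A₂ : Matrix (Fin n) (Fin r) ℝ)
    (hinv : IsUnit (A₁ * X * A₂))
    (lam₁ lam₂ : ℝ) (hlam₁ : 0 < lam₁) (hlam₂ : 0 < lam₂)
    (σ₁ σ₂ : ℝ) (hσ₁ : 0 ≤ σ₁) (hσ₂ : 0 ≤ σ₂)
    -- the orthogonal projections onto the column space of X*A₂ and the
    -- row space of A₁*X
    (P₁ : Matrix (Fin m) (Fin m) ℝ) (P₂ : Matrix (Fin n) (Fin n) ℝ)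
    (hP₁ : P₁ = X * A₂ * ((X * A₂)ᵀ * (X * A₂))⁻¹ * (X * A₂)ᵀ)
    (hP₂ : P₂ = (A₁ * X)ᵀ * (A₁ * X * (A₁ * X)ᵀ)⁻¹ * (A₁ * X))
    -- the compressed objective function with shift penalties
    (g : Matrix (Fin m) (Fin r) ℝ → Matrix (Fin n) (Fin r) ℝ → ℝ)
    (hg : ∀ U V, g U V =
      frobSq (A₁ * (X - U * Vᵀ)) + frobSq ((X - U * Vᵀ) * A₂)
        + lam₁ * frobSq ((1 - P₁) * (U * Vᵀ))
        + lam₂ * frobSq ((U * Vᵀ) * (1 - P₂))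
        + σ₁ * ∑ j, (∑ i, (X - U * Vᵀ) i j) ^ 2
        + σ₂ * ∑ i, (∑ j, (X - U * Vᵀ) i j) ^ 2)
    (Uopt : Matrix (Fin m) (Fin r) ℝ) (Vopt : Matrix (Fin n) (Fin r) ℝ)
    (hUopt : ∀ i j, 0 ≤ Uopt i j) (hVopt : ∀ i j, 0 ≤ Vopt i j)
    (hopt : ∀ U V, (∀ i j, 0 ≤ U i j) → (∀ i j, 0 ≤ V i j) →
      g Uopt Vopt ≤ g U V) :
    X = Uopt * Voptᵀ := by
  have hdet := (Matrix.isUnit_iff_isUnit_det _).1 hinv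
  have hXfac : X * A₂ * (A₁ * X * A₂)⁻¹ * (A₁ * X) = X := by
    subst hfact
    exact eq_mul_inv_mul_of_factorization U₀ V₀ A₁ A₂ hinv
  have hG₁ : IsUnit ((X * A₂)ᵀ * (X * A₂)).det := by
    apply isUnit_det_gram_of_leftInverse (L := (A₁ * X * A₂)⁻¹ * A₁)
    rw [Matrix.mul_assoc, ← Matrix.mul_assoc A₁, Matrix.nonsing_inv_mul _ hdet]
  have hG₂ : IsUnit (A₁ * X * (A₁ * X)ᵀ).det := by
    have h := isUnit_det_gram_of_leftInverse (K := (A₁ * X)ᵀ)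
      (L := (A₂ * (A₁ * X * A₂)⁻¹)ᵀ) (by
        rw [← Matrix.transpose_mul, ← Matrix.mul_assoc, Matrix.mul_nonsing_inv _ hdet,
          Matrix.transpose_one])
    rwa [Matrix.transpose_transpose] at h
  have hPK : P₁ * (X * A₂) = X * A₂ := by
    rw [hP₁, Matrix.mul_assoc, Matrix.mul_assoc (X * A₂), Matrix.nonsing_inv_mul _ hG₁,
      Matrix.mul_one]
  have hKP : A₁ * X * P₂ = A₁ * X := by
    rw [hP₂, ← Matrix.mul_assoc (A₁ * X), ← Matrix.mul_assoc (A₁ * X),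
      Matrix.mul_nonsing_inv _ hG₂, Matrix.one_mul]
  have hPX : P₁ * X = X := by
    conv_lhs => rw [← hXfac]
    rw [← Matrix.mul_assoc P₁, ← Matrix.mul_assoc P₁, hPK, hXfac]
  have hXP : X * P₂ = X := by
    conv_lhs => rw [← hXfac]
    rw [Matrix.mul_assoc, hKP, hXfac]
  have hg₀ : g U₀ V₀ = 0 := by
    rw [hg, ← hfact]
    simp [Matrix.sub_mul, Matrix.mul_sub, hPX, hXP, frobSq_zero]
  have hle := hopt U₀ V₀ hU₀ hV₀
  rw [hg₀, hg] at hle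
  have h₁ := frobSq_nonneg (A₁ * (X - Uopt * Voptᵀ))
  have h₂ := frobSq_nonneg ((X - Uopt * Voptᵀ) * A₂)
  have h₃ := mul_nonneg hlam₁.le (frobSq_nonneg ((1 - P₁) * (Uopt * Voptᵀ)))
  have h₄ := mul_nonneg hlam₂.le (frobSq_nonneg ((Uopt * Voptᵀ) * (1 - P₂)))
  have h₅ : 0 ≤ σ₁ * ∑ j, (∑ i, (X - Uopt * Voptᵀ) i j) ^ 2 :=
    mul_nonneg hσ₁ (Finset.sum_nonneg fun _ _ => sq_nonneg _)
  have h₆ : 0 ≤ σ₂ * ∑ i, (∑ j, (X - Uopt * Voptᵀ) i j) ^ 2 :=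
    mul_nonneg hσ₂ (Finset.sum_nonneg fun _ _ => sq_nonneg _)
  have hA : A₁ * (X - Uopt * Voptᵀ) = 0 := eq_zero_of_frobSq_eq_zero (by linarith)
  have hP : (1 - P₁) * (Uopt * Voptᵀ) = 0 := by
    have h : lam₁ * frobSq ((1 - P₁) * (Uopt * Voptᵀ)) = 0 := by linarith
    exact eq_zero_of_frobSq_eq_zero ((mul_eq_zero.1 h).resolve_left hlam₁.ne')
  set D := X - Uopt * Voptᵀ with hD
  have hPD : P₁ * D = D := by
    rw [Matrix.sub_mul, Matrix.one_mul, sub_eq_zero] at hP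
    rw [hD, Matrix.mul_sub, hPX, ← hP]
  obtain ⟨W, hW⟩ : ∃ W, D = X * A₂ * W :=
    ⟨((X * A₂)ᵀ * (X * A₂))⁻¹ * ((X * A₂)ᵀ * D), by
      conv_lhs => rw [← hPD, hP₁]
      simp only [Matrix.mul_assoc]⟩
  have hW₀ : W = 0 := by
    have h : A₁ * X * A₂ * W = 0 := by
      rw [← hA, hW]
      simp only [Matrix.mul_assoc]
    rw [← Matrix.one_mul W, ← Matrix.nonsing_inv_mul _ hdet, Matrix.mul_assoc, h,
      Matrix.mul_zero]
  rw [hW₀, Matrix.mul_zero] at hW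
  exact sub_eq_zero.1 hW
end

section
/- Let X ∈ ℝ^{m×n} be nonnegative and let A ∈ ℝ^{k×m} satisfy AAᵀ = I_k; write P_A^⊥ = I_m − AᵀA. Let U₀ ∈ ℝ^{m×r}, V₀ ∈ ℝ^{n×r} be nonnegative, set X₀ = U₀V₀ᵀ, and assume that every column sum of X₀ is positive and that |1 − (1ᵀX)_j/(1ᵀX₀)_j| ≤ ε for every column index j, where 1 = 1_m is the all-ones vector in ℝ^m. Suppose λ, ε ∈ (0, 1/2) and σ > 0. If Ũ, Ṽ are nonnegative matrices minimizing g(U,V) = ‖A(X−UVᵀ)‖_F² + λ‖P_A^⊥ UVᵀ‖_F² + σ‖1ᵀ(X−UVᵀ)‖² over all nonnegative U ∈ ℝ^{m×r}, V ∈ ℝ^{n×r}, then X̃ := ŨṼᵀ satisfies ‖X − X̃‖_F² ≤ c · ( ‖X − X₀‖_F² + ‖P_A^⊥ X‖_F² + ε²‖X‖_F² ), where c = max{6, 8/λ}. -/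
open Matrix

/-- Pythagorean decomposition along the row space of a matrix with orthonormal rows. -/
theorem frobSq_eq_add_of_mul_transpose_eq_one {m n k : ℕ} {A : Matrix (Fin k) (Fin m) ℝ}
    (hA : A * Aᵀ = 1) (M : Matrix (Fin m) (Fin n) ℝ) :
    frobSq M = frobSq (A * M) + frobSq ((1 - Aᵀ * A) * M) := by
  have hP : (1 - Aᵀ * A)ᵀ * (1 - Aᵀ * A) = 1 - Aᵀ * A := by
    have hAA : Aᵀ * A * (Aᵀ * A) = Aᵀ * A := by
      rw [Matrix.mul_assoc, ← Matrix.mul_assoc A, hA, Matrix.one_mul]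
    simp [Matrix.transpose_mul, Matrix.mul_sub, Matrix.sub_mul, hAA]
  have h₁ : (A * M)ᵀ * (A * M) = Mᵀ * (Aᵀ * A) * M := by
    simp only [Matrix.transpose_mul, Matrix.mul_assoc]
  have h₂ : ((1 - Aᵀ * A) * M)ᵀ * ((1 - Aᵀ * A) * M) = Mᵀ * (1 - Aᵀ * A) * M := by
    rw [Matrix.transpose_mul, Matrix.mul_assoc, ← Matrix.mul_assoc _ _ M, hP, Matrix.mul_assoc]
  rw [frobSq_eq_trace, frobSq_eq_trace, frobSq_eq_trace, h₁, h₂, ← Matrix.trace_add,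
    ← Matrix.add_mul, ← Matrix.mul_add, add_sub_cancel, Matrix.mul_one]

/-- Rescaling the columns of `Y` by factors within `ε` of `1` costs little in approximating `X`. -/
theorem frobSq_sub_mul_diagonal_le {m n : ℕ} (X Y : Matrix (Fin m) (Fin n) ℝ) {d : Fin n → ℝ}
    {ε : ℝ} (hε : ε ≤ 1 / 2) (hd : ∀ j, |1 - d j| ≤ ε) :
    frobSq (X - Y * Matrix.diagonal d) ≤ 4 * frobSq (X - Y) + 4 * (ε ^ 2 * frobSq X) := by
  simp only [frobSq, Finset.mul_sum, ← Finset.sum_add_distrib, Matrix.sub_apply,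
    Matrix.mul_diagonal]
  gcongr with i _ j _
  have he : (1 - d j) ^ 2 ≤ ε ^ 2 := sq_le_sq.2 ((hd j).trans (le_abs_self ε))
  have hd2 : d j ^ 2 ≤ 9 / 4 := by
    have := abs_le.1 (hd j)
    nlinarith
  have hsplit : X i j - Y i j * d j = (X i j - Y i j) * d j + X i j * (1 - d j) := by ring
  rw [hsplit]
  have h₁ := mul_le_mul_of_nonneg_left hd2 (sq_nonneg (X i j - Y i j))
  have h₂ := mul_le_mul_of_nonneg_left he (sq_nonneg (X i j))
  have h₃ := mul_nonneg (sq_nonneg (X i j)) (sq_nonneg ε)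
  nlinarith [sq_nonneg (7 * ((X i j - Y i j) * d j) - 9 * (X i j * (1 - d j)))]

/-- Error bound for one-sided compressed NMF, with orthonormal-row sketching
matrix, projection regularizer, and column-sum matching penalty
(Corollary: shifted one-sided objective). -/
theorem one_sided_orthogonal_error_with_shift
    {m n r k : ℕ}
    (X : Matrix (Fin m) (Fin n) ℝ) (hX : ∀ i j, 0 ≤ X i j)
    (A : Matrix (Fin k) (Fin m) ℝ) (hA : A * Aᵀ = 1)
    (U₀ : Matrix (Fin m) (Fin r) ℝ) (V₀ : Matrix (Fin n) (Fin r) ℝ)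
    (hU₀ : ∀ i j, 0 ≤ U₀ i j) (hV₀ : ∀ i j, 0 ≤ V₀ i j)
    (ε : ℝ) (hε0 : 0 < ε) (hε1 : ε < 1 / 2)
    -- every column sum of X₀ = U₀V₀ᵀ is positive and the column sums of X
    -- match those of X₀ up to relative error ε
    (hcolpos : ∀ j, 0 < ∑ i, (U₀ * V₀ᵀ) i j)
    (hcolsum : ∀ j,
      |1 - (∑ i, X i j) / (∑ i, (U₀ * V₀ᵀ) i j)| ≤ ε)
    (lam : ℝ) (hlam0 : 0 < lam) (hlam1 : lam < 1 / 2)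
    (σ : ℝ) (hσ : 0 < σ)
    (g : Matrix (Fin m) (Fin r) ℝ → Matrix (Fin n) (Fin r) ℝ → ℝ)
    (hg : ∀ U V, g U V =
      frobSq (A * (X - U * Vᵀ)) + lam * frobSq ((1 - Aᵀ * A) * (U * Vᵀ))
        + σ * ∑ j, (∑ i, (X - U * Vᵀ) i j) ^ 2)
    (Uopt : Matrix (Fin m) (Fin r) ℝ) (Vopt : Matrix (Fin n) (Fin r) ℝ)
    (hUopt : ∀ i j, 0 ≤ Uopt i j) (hVopt : ∀ i j, 0 ≤ Vopt i j)
    (hopt : ∀ U V, (∀ i j, 0 ≤ U i j) → (∀ i j, 0 ≤ V i j) →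
      g Uopt Vopt ≤ g U V) :
    frobSq (X - Uopt * Voptᵀ) ≤
      max 6 (8 / lam) *
        (frobSq (X - U₀ * V₀ᵀ) + frobSq ((1 - Aᵀ * A) * X)
          + ε ^ 2 * frobSq X) := by
  set d : Fin n → ℝ := fun j => (∑ i, X i j) / ∑ i, (U₀ * V₀ᵀ) i j with hd
  have hd0 : ∀ j, 0 ≤ d j := fun j =>
    div_nonneg (Finset.sum_nonneg fun i _ => hX i j) (hcolpos j).le
  have hfac : U₀ * (Matrix.diagonal d * V₀)ᵀ = U₀ * V₀ᵀ * Matrix.diagonal d := by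
    rw [Matrix.transpose_mul, Matrix.diagonal_transpose, Matrix.mul_assoc]
  have hcol : ∀ j, ∑ i, (X - U₀ * V₀ᵀ * Matrix.diagonal d) i j = 0 := fun j => by
    simp only [Matrix.sub_apply, Matrix.mul_diagonal, Finset.sum_sub_distrib, ← Finset.sum_mul, hd]
    rw [mul_div_cancel₀ _ (hcolpos j).ne', sub_self]
  have hle := hopt U₀ (Matrix.diagonal d * V₀) hU₀ fun i j => by
    rw [Matrix.diagonal_mul]
    exact mul_nonneg (hd0 i) (hV₀ i j)
  rw [hg, hg, hfac] at hle
  simp only [hcol] at hle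
  have hpen : 0 ≤ σ * ∑ j, (∑ i, (X - Uopt * Voptᵀ) i j) ^ 2 :=
    mul_nonneg hσ.le (Finset.sum_nonneg fun _ _ => sq_nonneg _)
  have hscale := frobSq_sub_mul_diagonal_le X (U₀ * V₀ᵀ) hε1.le hcolsum
  change frobSq (X - U₀ * V₀ᵀ * Matrix.diagonal d) ≤ _ at hscale
  generalize U₀ * V₀ᵀ * Matrix.diagonal d = Y at hle hscale
  rw [frobSq_eq_add_of_mul_transpose_eq_one hA] at hscale
  rw [frobSq_eq_add_of_mul_transpose_eq_one hA (X - Uopt * Voptᵀ)]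
  have hPopt := frobSq_sub_le ((1 - Aᵀ * A) * X) ((1 - Aᵀ * A) * (Uopt * Voptᵀ))
  rw [← Matrix.mul_sub] at hPopt
  have hPY := frobSq_sub_le ((1 - Aᵀ * A) * X) ((1 - Aᵀ * A) * (X - Y))
  rw [← Matrix.mul_sub, sub_sub_cancel] at hPY
  have hX₀ := frobSq_nonneg (X - U₀ * V₀ᵀ)
  have hXε := mul_nonneg (sq_nonneg ε) (frobSq_nonneg X)
  have hPX := frobSq_nonneg ((1 - Aᵀ * A) * X)
  have ha := frobSq_nonneg (A * (X - Uopt * Voptᵀ))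
  have hb := frobSq_nonneg ((1 - Aᵀ * A) * (X - Y))
  simp only [ne_eq, OfNat.ofNat_ne_zero, not_false_eq_true, zero_pow, Finset.sum_const_zero,
    mul_zero, add_zero] at hle
  generalize frobSq (X - U₀ * V₀ᵀ) = x₀ at *
  generalize ε ^ 2 * frobSq X = xe at *
  generalize frobSq ((1 - Aᵀ * A) * X) = px at *
  generalize frobSq (A * (X - Uopt * Voptᵀ)) = a at *
  generalize frobSq ((1 - Aᵀ * A) * (Uopt * Voptᵀ)) = b at *
  generalize frobSq ((1 - Aᵀ * A) * (X - Y)) = q at *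
  generalize frobSq ((1 - Aᵀ * A) * Y) = y at *
  have hobj : a + lam * b ≤ 4 * (x₀ + xe) + 2 * lam * px := by
    nlinarith [mul_le_mul_of_nonneg_left hPY hlam0.le]
  have hab : a + 2 * b ≤ 8 / lam * (x₀ + xe) + 4 * px := by
    have hdiv : 8 / lam * (x₀ + xe) + 4 * px = (8 * (x₀ + xe) + 4 * lam * px) / lam := by
      field_simp
    rw [hdiv, le_div_iff₀ hlam0]
    nlinarith
  have h6 := mul_le_mul_of_nonneg_right (le_max_left 6 (8 / lam)) hPX
  have h8 := mul_le_mul_of_nonneg_right (le_max_right 6 (8 / lam)) (add_nonneg hX₀ hXε)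
  linarith
end

section
/- Fix positive integers m, n, r, s, t. For i = 1,…,s let A_i be a real matrix with m columns and X_i^{(A)} ∈ ℝ^{m×n}; for j = 1,…,t let B_j be a real matrix with n rows and X_j^{(B)} ∈ ℝ^{m×n}. For U ∈ ℝ^{m×r}, V ∈ ℝ^{n×r} define F(U,V) = (1/2)Σ_{i=1}^s ‖A_i(X_i^{(A)} − UVᵀ)‖_F² + (1/2)Σ_{j=1}^t ‖(X_j^{(B)} − UVᵀ)B_j‖_F². Suppose the six matrices U, V, Σ_i A_iᵀA_i, Σ_j B_jB_jᵀ, Σ_i A_iᵀA_iX_i^{(A)}, and Σ_j X_j^{(B)}B_jB_jᵀ are all entrywise nonnegative, and suppose the matrix Σ_i A_iᵀA_i UVᵀV + Σ_j UVᵀB_jB_jᵀV is entrywise positive. Define U' = U ∘ (Σ_i A_iᵀA_iX_i^{(A)}V + Σ_j X_j^{(B)}B_jB_jᵀV) / (Σ_i A_iᵀA_iUVᵀV + Σ_j UVᵀB_jB_jᵀV). Then U' is entrywise nonnegative and F(U',V) ≤ F(U,V). Symmetrically, if Σ_i VUᵀA_iᵀA_iU + Σ_j B_jB_jᵀVUᵀU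 is entrywise positive and V' = V ∘ (Σ_i (X_i^{(A)})ᵀA_iᵀA_iU + Σ_j B_jB_jᵀ(X_j^{(B)})ᵀU) / (Σ_i VUᵀA_iᵀA_iU + Σ_j B_jB_jᵀVUᵀU), then V' is entrywise nonnegative and F(U,V') ≤ F(U,V). -/
open Matrix

/-- The generic sketched NMF objective
`F(U,V) = (1/2) Σᵢ ‖Aᵢ(Xᵢ⁽ᴬ⁾ − UVᵀ)‖_F² + (1/2) Σⱼ ‖(Xⱼ⁽ᴮ⁾ − UVᵀ)Bⱼ‖_F²`. -/
noncomputable def sketchObj {m n r s t : ℕ} {ka : Fin s → ℕ} {kb : Fin t → ℕ}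
    (A : ∀ i, Matrix (Fin (ka i)) (Fin m) ℝ)
    (XA : Fin s → Matrix (Fin m) (Fin n) ℝ)
    (B : ∀ j, Matrix (Fin n) (Fin (kb j)) ℝ)
    (XB : Fin t → Matrix (Fin m) (Fin n) ℝ)
    (U : Matrix (Fin m) (Fin r) ℝ) (V : Matrix (Fin n) (Fin r) ℝ) : ℝ :=
  (1 / 2) * ∑ i, frobSq (A i * (XA i - U * Vᵀ))
    + (1 / 2) * ∑ j, frobSq ((XB j - U * Vᵀ) * B j)

theorem frobSq_transpose {m n : ℕ} (M : Matrix (Fin m) (Fin n) ℝ) :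
    frobSq Mᵀ = frobSq M := by
  simp only [frobSq, Matrix.transpose_apply]
  exact Finset.sum_comm

theorem frobSq_sub {m n : ℕ} (M E : Matrix (Fin m) (Fin n) ℝ) :
    frobSq (M - E) = frobSq M - 2 * (Eᵀ * M).trace + (Eᵀ * E).trace := by
  have h : (Mᵀ * E).trace = (Eᵀ * M).trace := by
    rw [← Matrix.trace_transpose, Matrix.transpose_mul, Matrix.transpose_transpose]
  simp only [frobSq_eq_trace, Matrix.transpose_sub, Matrix.sub_mul, Matrix.mul_sub,
    Matrix.trace_sub, h]
  ring

theorem frobSq_mul_sub_add {k m n r : ℕ} (A : Matrix (Fin k) (Fin m) ℝ)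
    (X : Matrix (Fin m) (Fin n) ℝ) (U D : Matrix (Fin m) (Fin r) ℝ)
    (V : Matrix (Fin n) (Fin r) ℝ) :
    frobSq (A * (X - (U + D) * Vᵀ)) = frobSq (A * (X - U * Vᵀ))
      + 2 * (Dᵀ * (Aᵀ * A * U * Vᵀ * V - Aᵀ * A * X * V)).trace
      + (Dᵀ * (Aᵀ * A * D * (Vᵀ * V))).trace := by
  have h : A * (X - (U + D) * Vᵀ) = A * (X - U * Vᵀ) - A * D * Vᵀ := by
    simp only [Matrix.mul_sub, Matrix.add_mul, Matrix.mul_add, Matrix.mul_assoc]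
    abel
  have hc (Y : Matrix (Fin m) (Fin n) ℝ) :
      ((A * D * Vᵀ)ᵀ * (A * Y)).trace = (Dᵀ * (Aᵀ * A * Y * V)).trace := by
    rw [Matrix.transpose_mul, Matrix.transpose_transpose, Matrix.mul_assoc, Matrix.trace_mul_comm]
    simp only [Matrix.transpose_mul, Matrix.mul_assoc]
  have hq := hc (D * Vᵀ)
  rw [← Matrix.mul_assoc A D] at hq
  rw [h, frobSq_sub, hc, hq]
  simp only [Matrix.mul_sub, Matrix.sub_mul, Matrix.trace_sub, Matrix.mul_assoc]
  ring

theorem frobSq_sub_add_mul {k m n r : ℕ} (B : Matrix (Fin n) (Fin k) ℝ)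
    (X : Matrix (Fin m) (Fin n) ℝ) (U D : Matrix (Fin m) (Fin r) ℝ)
    (V : Matrix (Fin n) (Fin r) ℝ) :
    frobSq ((X - (U + D) * Vᵀ) * B) = frobSq ((X - U * Vᵀ) * B)
      + 2 * (Dᵀ * (U * Vᵀ * (B * Bᵀ) * V - X * (B * Bᵀ) * V)).trace
      + (Dᵀ * (D * (Vᵀ * (B * Bᵀ) * V))).trace := by
  have h : (X - (U + D) * Vᵀ) * B = (X - U * Vᵀ) * B - D * Vᵀ * B := by
    simp only [Matrix.sub_mul, Matrix.add_mul]
    abel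
  have hc (Y : Matrix (Fin m) (Fin n) ℝ) :
      ((D * Vᵀ * B)ᵀ * (Y * B)).trace = (Dᵀ * (Y * (B * Bᵀ) * V)).trace := by
    rw [Matrix.mul_assoc D, Matrix.transpose_mul, Matrix.mul_assoc, Matrix.trace_mul_comm]
    simp only [Matrix.transpose_mul, Matrix.transpose_transpose, Matrix.mul_assoc]
  rw [h, frobSq_sub, hc, hc]
  simp only [Matrix.mul_sub, Matrix.sub_mul, Matrix.trace_sub, Matrix.mul_assoc]
  ring

theorem trace_transpose_mul_eq_sum {m r : ℕ} (D M : Matrix (Fin m) (Fin r) ℝ) :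
    (Dᵀ * M).trace = ∑ i, ∑ a, D i a * M i a := by
  simp only [Matrix.trace, Matrix.diag, Matrix.mul_apply, Matrix.transpose_apply]
  exact Finset.sum_comm

/-- The second-order expansion of the objective in its first factor. -/
theorem sketchObj_add {m n r s t : ℕ} {ka : Fin s → ℕ} {kb : Fin t → ℕ}
    (A : ∀ i, Matrix (Fin (ka i)) (Fin m) ℝ)
    (XA : Fin s → Matrix (Fin m) (Fin n) ℝ)
    (B : ∀ j, Matrix (Fin n) (Fin (kb j)) ℝ)
    (XB : Fin t → Matrix (Fin m) (Fin n) ℝ)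
    (U D : Matrix (Fin m) (Fin r) ℝ) (V : Matrix (Fin n) (Fin r) ℝ) :
    sketchObj A XA B XB (U + D) V = sketchObj A XA B XB U V
      + (Dᵀ * (((∑ p, (A p)ᵀ * A p) * U * Vᵀ * V + U * Vᵀ * (∑ q, B q * (B q)ᵀ) * V)
          - ((∑ p, (A p)ᵀ * A p * XA p) * V + (∑ q, XB q * (B q * (B q)ᵀ)) * V))).trace
      + (1 / 2) * ((Dᵀ * ((∑ p, (A p)ᵀ * A p) * D * (Vᵀ * V))).trace
        + (Dᵀ * (D * (Vᵀ * (∑ q, B q * (B q)ᵀ) * V))).trace) := by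
  simp only [sketchObj, frobSq_mul_sub_add, frobSq_sub_add_mul]
  simp only [Finset.sum_add_distrib, ← Finset.mul_sum, Matrix.mul_sub, Matrix.mul_add, Matrix.trace_sub, Matrix.trace_add,
    Matrix.sum_mul, Matrix.mul_sum, Matrix.trace_sum, Finset.sum_sub_distrib]
  ring

/-- The diagonal majorization of a nonnegative symmetric quadratic form. -/
theorem sum_mul_mul_le_of_symm {ι : Type*} [Fintype ι] (K : ι → ι → ℝ)
    (hK : ∀ p q, 0 ≤ K p q) (hs : ∀ p q, K p q = K q p) (u e : ι → ℝ) (hu : ∀ p, 0 ≤ u p) :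
    ∑ p, (u p * e p) * ∑ q, K p q * (u q * e q)
      ≤ ∑ p, (u p * e p ^ 2) * ∑ q, K p q * u q := by
  have h : ∑ p, ∑ q, K p q * u p * u q * e p ^ 2 = ∑ p, ∑ q, K p q * u p * u q * e q ^ 2 := by
    rw [Finset.sum_comm]
    refine Finset.sum_congr rfl fun p _ => Finset.sum_congr rfl fun q _ => ?_
    rw [hs]
    ring
  have hle : ∑ p, ∑ q, 2 * (K p q * u p * u q * (e p * e q))
      ≤ ∑ p, ∑ q, (K p q * u p * u q * e p ^ 2 + K p q * u p * u q * e q ^ 2) := by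
    refine Finset.sum_le_sum fun p _ => Finset.sum_le_sum fun q _ => ?_
    nlinarith [mul_nonneg (mul_nonneg (mul_nonneg (hK p q) (hu p)) (hu q)) (sq_nonneg (e p - e q))]
  simp only [Finset.sum_add_distrib, ← h, ← Finset.mul_sum] at hle
  have h₁ : ∑ p, (u p * e p) * ∑ q, K p q * (u q * e q)
      = ∑ p, ∑ q, K p q * u p * u q * (e p * e q) := by
    simp only [Finset.mul_sum]
    exact Finset.sum_congr rfl fun p _ => Finset.sum_congr rfl fun q _ => by ring
  have h₂ : ∑ p, (u p * e p ^ 2) * ∑ q, K p q * u q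
      = ∑ p, ∑ q, K p q * u p * u q * e p ^ 2 := by
    simp only [Finset.mul_sum]
    exact Finset.sum_congr rfl fun p _ => Finset.sum_congr rfl fun q _ => by ring
  rw [h₁, h₂]
  linarith

theorem trace_transpose_mul_mul_le {m r : ℕ} (P : Matrix (Fin m) (Fin m) ℝ)
    (Q : Matrix (Fin r) (Fin r) ℝ) (hP : ∀ i k, 0 ≤ P i k) (hQ : ∀ a b, 0 ≤ Q a b)
    (hPs : Pᵀ = P) (hQs : Qᵀ = Q) (U e : Matrix (Fin m) (Fin r) ℝ) (hU : ∀ i a, 0 ≤ U i a) :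
    ((U ⊙ e)ᵀ * (P * (U ⊙ e) * Q)).trace
      ≤ ∑ i, ∑ a, (U i a * e i a ^ 2) * (P * U * Q) i a := by
  have hmul (W : Matrix (Fin m) (Fin r) ℝ) (i : Fin m) (a : Fin r) :
      (P * W * Q) i a = ∑ q : Fin m × Fin r, (P i q.1 * Q q.2 a) * W q.1 q.2 := by
    simp only [Matrix.mul_apply, Fintype.sum_prod_type, Finset.sum_mul]
    rw [Finset.sum_comm]
    exact Finset.sum_congr rfl fun p _ => Finset.sum_congr rfl fun q _ => by ring
  have h := sum_mul_mul_le_of_symm (fun p q : Fin m × Fin r => P p.1 q.1 * Q q.2 p.2)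
    (fun p q => mul_nonneg (hP _ _) (hQ _ _))
    (fun p q => by
      rw [← congrFun₂ hPs p.1 q.1, ← congrFun₂ hQs q.2 p.2]
      rfl)
    (fun p => U p.1 p.2) (fun p => e p.1 p.2) (fun p => hU _ _)
  rw [trace_transpose_mul_eq_sum]
  simp only [hmul, Matrix.hadamard_apply]
  simpa only [Fintype.sum_prod_type] using h

theorem mul_apply_nonneg {a b c : ℕ} {P : Matrix (Fin a) (Fin b) ℝ}
    {Q : Matrix (Fin b) (Fin c) ℝ} (hP : ∀ i j, 0 ≤ P i j) (hQ : ∀ i j, 0 ≤ Q i j)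
    (i : Fin a) (j : Fin c) : 0 ≤ (P * Q) i j := by
  rw [Matrix.mul_apply]
  exact Finset.sum_nonneg fun k _ => mul_nonneg (hP i k) (hQ k j)

theorem sketchObj_update_left_le
    {m n r s t : ℕ} {ka : Fin s → ℕ} {kb : Fin t → ℕ}
    (A : ∀ i, Matrix (Fin (ka i)) (Fin m) ℝ)
    (XA : Fin s → Matrix (Fin m) (Fin n) ℝ)
    (B : ∀ j, Matrix (Fin n) (Fin (kb j)) ℝ)
    (XB : Fin t → Matrix (Fin m) (Fin n) ℝ)
    (U : Matrix (Fin m) (Fin r) ℝ) (V : Matrix (Fin n) (Fin r) ℝ)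
    (hU : ∀ i a, 0 ≤ U i a) (hV : ∀ i a, 0 ≤ V i a)
    (hSA : ∀ i j, 0 ≤ (∑ p, (A p)ᵀ * A p) i j)
    (hSB : ∀ i j, 0 ≤ (∑ q, B q * (B q)ᵀ) i j)
    (L N : Matrix (Fin m) (Fin r) ℝ)
    (hL : L = (∑ p, (A p)ᵀ * A p) * U * Vᵀ * V + U * Vᵀ * (∑ q, B q * (B q)ᵀ) * V)
    (hN : N = (∑ p, (A p)ᵀ * A p * XA p) * V + (∑ q, XB q * (B q * (B q)ᵀ)) * V)
    (hpos : ∀ i a, 0 < L i a) :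
    sketchObj A XA B XB (Matrix.of fun i a => U i a * N i a / L i a) V
      ≤ sketchObj A XA B XB U V := by
  set e : Matrix (Fin m) (Fin r) ℝ := Matrix.of fun i a => (N i a - L i a) / L i a with he
  have hD : (Matrix.of fun i a => U i a * N i a / L i a) = U + U ⊙ e := by
    ext i a
    have := (hpos i a).ne'
    simp only [he, Matrix.of_apply, Matrix.add_apply, Matrix.hadamard_apply]
    field_simp
    ring
  have h₁ := trace_transpose_mul_mul_le (∑ p, (A p)ᵀ * A p) (Vᵀ * V) hSA
    (mul_apply_nonneg (fun i j => hV j i) hV)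
    (by simp [Matrix.transpose_sum]) (by simp) U e hU
  have h₂ := trace_transpose_mul_mul_le 1 (Vᵀ * (∑ q, B q * (B q)ᵀ) * V)
    (fun i k => by rw [Matrix.one_apply]; split_ifs <;> norm_num)
    (mul_apply_nonneg (mul_apply_nonneg (fun i j => hV j i) hSB) hV)
    (by simp) (by simp [Matrix.transpose_sum, Matrix.mul_assoc]) U e hU
  rw [Matrix.one_mul, Matrix.one_mul] at h₂
  have hlin : ((U ⊙ e)ᵀ * (L - N)).trace = -∑ i, ∑ a, (U i a * e i a ^ 2) * L i a := by
    rw [trace_transpose_mul_eq_sum]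
    simp only [← Finset.sum_neg_distrib]
    refine Finset.sum_congr rfl fun i _ => Finset.sum_congr rfl fun a _ => ?_
    have := (hpos i a).ne'
    simp only [he, Matrix.of_apply, Matrix.sub_apply, Matrix.hadamard_apply]
    field_simp
    ring
  have hquad : ∑ i, ∑ a, (U i a * e i a ^ 2) * ((∑ p, (A p)ᵀ * A p) * U * (Vᵀ * V)) i a
      + ∑ i, ∑ a, (U i a * e i a ^ 2) * (U * (Vᵀ * (∑ q, B q * (B q)ᵀ) * V)) i a
      = ∑ i, ∑ a, (U i a * e i a ^ 2) * L i a := by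
    simp only [hL, Matrix.add_apply, mul_add, Finset.sum_add_distrib, Matrix.mul_assoc]
  have hnonneg : 0 ≤ ∑ i, ∑ a, (U i a * e i a ^ 2) * L i a :=
    Finset.sum_nonneg fun i _ => Finset.sum_nonneg fun a _ =>
      mul_nonneg (mul_nonneg (hU i a) (sq_nonneg _)) (hpos i a).le
  rw [hD, sketchObj_add, ← hL, ← hN, hlin]
  linarith

theorem sketchObj_transpose {m n r s t : ℕ} {ka : Fin s → ℕ} {kb : Fin t → ℕ}
    (A : ∀ i, Matrix (Fin (ka i)) (Fin m) ℝ)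
    (XA : Fin s → Matrix (Fin m) (Fin n) ℝ)
    (B : ∀ j, Matrix (Fin n) (Fin (kb j)) ℝ)
    (XB : Fin t → Matrix (Fin m) (Fin n) ℝ)
    (U : Matrix (Fin m) (Fin r) ℝ) (V : Matrix (Fin n) (Fin r) ℝ) :
    sketchObj (fun j => (B j)ᵀ) (fun j => (XB j)ᵀ) (fun i => (A i)ᵀ) (fun i => (XA i)ᵀ) V U
      = sketchObj A XA B XB U V := by
  have hA (i) : ((XA i)ᵀ - V * Uᵀ) * (A i)ᵀ = (A i * (XA i - U * Vᵀ))ᵀ := by simp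
  have hB (j) : (B j)ᵀ * ((XB j)ᵀ - V * Uᵀ) = ((XB j - U * Vᵀ) * B j)ᵀ := by simp
  simp only [sketchObj, hA, hB, frobSq_transpose]
  ring

theorem multiplicative_update_nonneg {m n r : ℕ} {U L : Matrix (Fin m) (Fin r) ℝ}
    {V : Matrix (Fin n) (Fin r) ℝ} {P Q : Matrix (Fin m) (Fin n) ℝ}
    (hU : ∀ i a, 0 ≤ U i a) (hV : ∀ i a, 0 ≤ V i a) (hP : ∀ i j, 0 ≤ P i j)
    (hQ : ∀ i j, 0 ≤ Q i j) (hL : ∀ i a, 0 < L i a) (i : Fin m) (a : Fin r) :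
    0 ≤ U i a * (P * V + Q * V) i a / L i a :=
  div_nonneg (mul_nonneg (hU i a) (add_nonneg
    (mul_apply_nonneg hP hV i a) (mul_apply_nonneg hQ hV i a))) (hL i a).le

/-- General monotonicity of multiplicative updates for sums of sketched
least-squares NMF objectives (Theorem: sketched multiplicative updates). -/
theorem multiplicative_updates_monotone
    {m n r s t : ℕ} {ka : Fin s → ℕ} {kb : Fin t → ℕ}
    (A : ∀ i, Matrix (Fin (ka i)) (Fin m) ℝ)
    (XA : Fin s → Matrix (Fin m) (Fin n) ℝ)
    (B : ∀ j, Matrix (Fin n) (Fin (kb j)) ℝ)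
    (XB : Fin t → Matrix (Fin m) (Fin n) ℝ)
    (U : Matrix (Fin m) (Fin r) ℝ) (V : Matrix (Fin n) (Fin r) ℝ)
    (hU : ∀ i a, 0 ≤ U i a) (hV : ∀ i a, 0 ≤ V i a)
    (hSA : ∀ i j, 0 ≤ (∑ p, (A p)ᵀ * A p) i j)
    (hSB : ∀ i j, 0 ≤ (∑ q, B q * (B q)ᵀ) i j)
    (hSAX : ∀ i j, 0 ≤ (∑ p, (A p)ᵀ * A p * XA p) i j)
    (hSXB : ∀ i j, 0 ≤ (∑ q, XB q * (B q * (B q)ᵀ)) i j) :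
    -- update of U
    (((∀ i a, 0 <
        ((∑ p, (A p)ᵀ * A p) * U * Vᵀ * V
          + U * Vᵀ * (∑ q, B q * (B q)ᵀ) * V) i a) →
      (∀ i a, 0 ≤
        (Matrix.of fun i a => U i a *
          (((∑ p, (A p)ᵀ * A p * XA p) * V
              + (∑ q, XB q * (B q * (B q)ᵀ)) * V) i a)
          / (((∑ p, (A p)ᵀ * A p) * U * Vᵀ * V
              + U * Vᵀ * (∑ q, B q * (B q)ᵀ) * V) i a) :
          Matrix (Fin m) (Fin r) ℝ) i a) ∧
      sketchObj A XA B XB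
        (Matrix.of fun i a => U i a *
          (((∑ p, (A p)ᵀ * A p * XA p) * V
              + (∑ q, XB q * (B q * (B q)ᵀ)) * V) i a)
          / (((∑ p, (A p)ᵀ * A p) * U * Vᵀ * V
              + U * Vᵀ * (∑ q, B q * (B q)ᵀ) * V) i a)) V
        ≤ sketchObj A XA B XB U V)
    -- update of V
    ∧ ((∀ i a, 0 <
        (V * Uᵀ * (∑ p, (A p)ᵀ * A p) * U
          + (∑ q, B q * (B q)ᵀ) * V * Uᵀ * U) i a) →
      (∀ i a, 0 ≤
        (Matrix.of fun i a => V i a *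
          (((∑ p, (A p)ᵀ * A p * XA p)ᵀ * U
              + (∑ q, B q * (B q)ᵀ * (XB q)ᵀ) * U) i a)
          / ((V * Uᵀ * (∑ p, (A p)ᵀ * A p) * U
              + (∑ q, B q * (B q)ᵀ) * V * Uᵀ * U) i a) :
          Matrix (Fin n) (Fin r) ℝ) i a) ∧
      sketchObj A XA B XB U
        (Matrix.of fun i a => V i a *
          (((∑ p, (A p)ᵀ * A p * XA p)ᵀ * U
              + (∑ q, B q * (B q)ᵀ * (XB q)ᵀ) * U) i a)
          / ((V * Uᵀ * (∑ p, (A p)ᵀ * A p) * U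
              + (∑ q, B q * (B q)ᵀ) * V * Uᵀ * U) i a))
        ≤ sketchObj A XA B XB U V)) := by
  have hXB : (∑ q, B q * (B q)ᵀ * (XB q)ᵀ) = (∑ q, XB q * (B q * (B q)ᵀ))ᵀ := by
    simp [Matrix.transpose_sum, Matrix.mul_assoc]
  refine ⟨fun hpos => ⟨multiplicative_update_nonneg hU hV hSAX hSXB hpos,
    sketchObj_update_left_le A XA B XB U V hU hV hSA hSB _ _ rfl rfl hpos⟩,
    fun hpos => ⟨?_, ?_⟩⟩
  · rw [hXB]
    exact multiplicative_update_nonneg hV hU (fun i j => hSAX j i) (fun i j => hSXB j i) hpos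
  · rw [← sketchObj_transpose A XA B XB, ← sketchObj_transpose A XA B XB]
    refine sketchObj_update_left_le _ _ _ _ V U hV hU ?_ ?_ _ _ ?_ ?_ hpos
    · simpa using hSB
    · simpa using hSA
    · simp only [Matrix.transpose_transpose]
      exact add_comm _ _
    · simp only [Matrix.transpose_transpose, Matrix.transpose_sum, Matrix.transpose_mul]
      exact add_comm _ _
end

section
/- Let X ∈ ℝ^{m×n} be nonnegative, let A ∈ ℝ^{k×m} be an arbitrary matrix, let λ ∈ [0,1], and let σ ≥ max{(AᵀA)₋}. Define the objective g(U,V) = ‖A(X−UVᵀ)‖_F² + λ‖UVᵀ‖_F² + σ‖1ᵀ(X−UVᵀ)‖² for U ∈ ℝ^{m×r}, V ∈ ℝ^{n×r}, where 1 = 1_m. Then for any entrywise nonnegative U, V for which the respective denominators below are entrywise positive, g does not increase under the updates U ← U ∘ (AᵀAXV + σ11ᵀXV) / (AᵀAUVᵀV + σ11ᵀUVᵀV + λUVᵀV) and V ← V ∘ (XᵀAᵀAU + σXᵀ11ᵀU) / (VUᵀAᵀAU + σVUᵀ11ᵀU + λVUᵀU), and the updated matrices remain entrywise nonnegative. -/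
open Matrix

/-- The all-ones matrix `1_a 1_bᵀ`. -/
def onesMat (a b : ℕ) : Matrix (Fin a) (Fin b) ℝ := Matrix.of fun _ _ => 1

/-- One multiplicative step for the quadratic function with entrywise nonnegative symmetric Hessian
`Q` and linear term `b` does not increase it: the exact second-order increment is nonpositive. -/
theorem multiplicative_step_increment_nonpos {ι : Type*} [Fintype ι] (Q : Matrix ι ι ℝ)
    (hQs : Qᵀ = Q) (hQ : ∀ i j, 0 ≤ Q i j) (u b e : ι → ℝ) (hu : ∀ i, 0 ≤ u i)
    (hd : ∀ i, 0 < (Q *ᵥ u) i) (he : ∀ i, e i = u i * b i / (Q *ᵥ u) i - u i) :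
    2 * ((Q *ᵥ u - b) ⬝ᵥ e) + e ⬝ᵥ (Q *ᵥ e) ≤ 0 := by
  set d := Q *ᵥ u with hd_def
  set t : ι → ℝ := fun i => (b i - d i) / d i with ht
  have hdt (i) : b i - d i = d i * t i := by
    have := (hd i).ne'
    simp only [ht]
    field_simp
  have het (i) : e i = u i * t i := by
    have := (hd i).ne'
    rw [he i]
    simp only [ht]
    field_simp
  have hlin : (d - b) ⬝ᵥ e = -∑ i, u i * d i * t i ^ 2 := by
    rw [dotProduct, ← Finset.sum_neg_distrib]
    refine Finset.sum_congr rfl fun i _ => ?_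
    rw [Pi.sub_apply, het, ← neg_sub, hdt]
    ring
  have hquad : e ⬝ᵥ (Q *ᵥ e) = ∑ i, ∑ j, Q i j * u i * u j * (t i * t j) := by
    simp only [dotProduct, mulVec, Finset.mul_sum, het]
    exact Finset.sum_congr rfl fun i _ => Finset.sum_congr rfl fun j _ => by ring
  have hrow : ∑ i, u i * d i * t i ^ 2 = ∑ i, ∑ j, Q i j * u i * u j * t i ^ 2 := by
    refine Finset.sum_congr rfl fun i _ => ?_
    simp only [hd_def, mulVec, dotProduct, Finset.mul_sum, Finset.sum_mul]
    exact Finset.sum_congr rfl fun j _ => by ring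
  have hcol : ∑ i, u i * d i * t i ^ 2 = ∑ i, ∑ j, Q i j * u i * u j * t j ^ 2 := by
    rw [hrow, Finset.sum_comm]
    refine Finset.sum_congr rfl fun i _ => Finset.sum_congr rfl fun j _ => ?_
    rw [← congr_fun₂ hQs i j, transpose_apply]
    ring
  have hcross : 2 * (e ⬝ᵥ (Q *ᵥ e)) ≤
      ∑ i, u i * d i * t i ^ 2 + ∑ i, u i * d i * t i ^ 2 := by
    nth_rewrite 1 [hrow]
    rw [hcol, hquad, Finset.mul_sum, ← Finset.sum_add_distrib]
    refine Finset.sum_le_sum fun i _ => ?_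
    rw [Finset.mul_sum, ← Finset.sum_add_distrib]
    refine Finset.sum_le_sum fun j _ => ?_
    have := mul_nonneg (mul_nonneg (mul_nonneg (hQ i j) (hu i)) (hu j)) (sq_nonneg (t i - t j))
    linarith
  have hpos : 0 ≤ ∑ i, u i * d i * t i ^ 2 :=
    Finset.sum_nonneg fun i _ => mul_nonneg (mul_nonneg (hu i) (hd i).le) (sq_nonneg _)
  rw [hlin]
  linarith

/-- Matrix form of `multiplicative_step_increment_nonpos` for the Hessian `U ↦ P * U * G`. -/
theorem multiplicative_step_trace_increment_nonpos {ι κ : Type*} [Fintype ι] [Fintype κ]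
    (P : Matrix ι ι ℝ) (G : Matrix κ κ ℝ) (hPs : Pᵀ = P) (hGs : Gᵀ = G)
    (hP : ∀ i j, 0 ≤ P i j) (hG : ∀ a b, 0 ≤ G a b) (U B E : Matrix ι κ ℝ)
    (hU : ∀ i a, 0 ≤ U i a) (hD : ∀ i a, 0 < (P * U * G) i a)
    (hE : ∀ i a, E i a = U i a * B i a / (P * U * G) i a - U i a) :
    2 * ((P * U * G - B)ᵀ * E).trace + (Eᵀ * (P * E * G)).trace ≤ 0 := by
  have hvec (M : Matrix ι κ ℝ) : kroneckerMap (· * ·) G P *ᵥ vec M = vec (P * M * G) := by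
    rw [kronecker_mulVec_vec, hGs]
  have h := multiplicative_step_increment_nonpos (kroneckerMap (· * ·) G P)
    (by rw [← kroneckerMap_transpose, hPs, hGs])
    (fun i j => mul_nonneg (hG _ _) (hP _ _)) (vec U) (vec B) (vec E)
    (fun i => hU _ _) (fun i => by rw [hvec]; exact hD _ _)
    (fun i => by rw [hvec]; exact hE _ _)
  rwa [hvec, hvec, ← vec_sub, vec_dotProduct_vec, vec_dotProduct_vec] at h

theorem sum_sq_colSum_eq_trace {m n : ℕ} (M : Matrix (Fin m) (Fin n) ℝ) :
    ∑ j, (∑ i, M i j) ^ 2 = (Mᵀ * (onesMat m m * M)).trace := by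
  simp only [trace, diag_apply, mul_apply, transpose_apply, onesMat, of_apply, one_mul, pow_two,
    Finset.sum_mul]

theorem onesMat_transpose (a b : ℕ) : (onesMat a b)ᵀ = onesMat b a := rfl

/-- Exact second-order expansion of a shifted quadratic form with a ridge term. -/
theorem trace_quadratic_add {ι κ : Type*} [Fintype ι] [Fintype κ] [DecidableEq ι]
    (P : Matrix ι ι ℝ) (hP : Pᵀ = P) (lam : ℝ) (X Y Z : Matrix ι κ ℝ) :
    ((X - (Y + Z))ᵀ * (P * (X - (Y + Z)))).trace + lam * ((Y + Z)ᵀ * (Y + Z)).trace =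
      ((X - Y)ᵀ * (P * (X - Y))).trace + lam * (Yᵀ * Y).trace
        + (2 * (((P + lam • 1) * Y - P * X)ᵀ * Z).trace + (Zᵀ * ((P + lam • 1) * Z)).trace) := by
  have hsymm (S T : Matrix ι κ ℝ) : (Sᵀ * (P * T)).trace = (Tᵀ * (P * S)).trace := by
    rw [← trace_transpose, transpose_mul, transpose_mul, hP, transpose_transpose, Matrix.mul_assoc]
  have hcomm : (Zᵀ * Y).trace = (Yᵀ * Z).trace := by
    rw [← trace_transpose, transpose_mul, transpose_transpose]
  simp only [transpose_sub, transpose_add, transpose_mul, transpose_smul, hP,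
    Matrix.mul_sub, Matrix.sub_mul, Matrix.mul_add, Matrix.add_mul, Matrix.mul_assoc,
    Matrix.smul_mul, Matrix.mul_smul, Matrix.one_mul, trace_add, trace_sub, trace_smul,
    smul_eq_mul, hcomm, hsymm Z X, hsymm Z Y]
  ring

theorem matrix_mul_nonneg {ι κ μ : Type*} [Fintype κ] {M : Matrix ι κ ℝ} {N : Matrix κ μ ℝ}
    (hM : ∀ i j, 0 ≤ M i j) (hN : ∀ i j, 0 ≤ N i j) (i : ι) (j : μ) : 0 ≤ (M * N) i j :=
  Finset.sum_nonneg fun _ _ => mul_nonneg (hM _ _) (hN _ _)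

/-- Multiplicative updates for the one-sided compressed NMF objective with a
general sketching matrix, ridge regularizer, and nonnegativity-correction
shift (Corollary: one-sided updates, nonorthogonal A). -/
theorem one_sided_general_multiplicative_updates
    {m n r k : ℕ}
    (X : Matrix (Fin m) (Fin n) ℝ) (hX : ∀ i j, 0 ≤ X i j)
    (A : Matrix (Fin k) (Fin m) ℝ)
    (lam : ℝ) (hlam0 : 0 ≤ lam) (hlam1 : lam ≤ 1)
    (σ : ℝ) (hσ : ∀ i j, max (-((Aᵀ * A) i j)) 0 ≤ σ)
    (g : Matrix (Fin m) (Fin r) ℝ → Matrix (Fin n) (Fin r) ℝ → ℝ)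
    (hg : ∀ U V, g U V =
      frobSq (A * (X - U * Vᵀ)) + lam * frobSq (U * Vᵀ)
        + σ * ∑ j, (∑ i, (X - U * Vᵀ) i j) ^ 2)
    (U : Matrix (Fin m) (Fin r) ℝ) (V : Matrix (Fin n) (Fin r) ℝ)
    (hU : ∀ i a, 0 ≤ U i a) (hV : ∀ i a, 0 ≤ V i a)
    (NumU DenU : Matrix (Fin m) (Fin r) ℝ)
    (hNumU : NumU = Aᵀ * A * X * V + σ • (onesMat m m * X * V))
    (hDenU : DenU = Aᵀ * A * U * Vᵀ * V
      + σ • (onesMat m m * U * Vᵀ * V) + lam • (U * Vᵀ * V))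
    (NumV DenV : Matrix (Fin n) (Fin r) ℝ)
    (hNumV : NumV = Xᵀ * Aᵀ * A * U + σ • (Xᵀ * onesMat m m * U))
    (hDenV : DenV = V * Uᵀ * Aᵀ * A * U
      + σ • (V * Uᵀ * onesMat m m * U) + lam • (V * Uᵀ * U)) :
    ((∀ i a, 0 < DenU i a) →
      (∀ i a, 0 ≤ (Matrix.of fun i a => U i a * NumU i a / DenU i a :
        Matrix (Fin m) (Fin r) ℝ) i a) ∧
      g (Matrix.of fun i a => U i a * NumU i a / DenU i a) V ≤ g U V)
    ∧ ((∀ i a, 0 < DenV i a) →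
      (∀ i a, 0 ≤ (Matrix.of fun i a => V i a * NumV i a / DenV i a :
        Matrix (Fin n) (Fin r) ℝ) i a) ∧
      g U (Matrix.of fun i a => V i a * NumV i a / DenV i a) ≤ g U V) := by
  set P : Matrix (Fin m) (Fin m) ℝ := Aᵀ * A + σ • onesMat m m with hP_def
  set R : Matrix (Fin m) (Fin m) ℝ := P + lam • 1 with hR_def
  have hPs : Pᵀ = P := by simp [hP_def, onesMat_transpose]
  have hRs : Rᵀ = R := by simp [hR_def, hPs]
  have hP (i j) : 0 ≤ P i j := by
    have := (le_max_left _ _).trans (hσ i j)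
    simp only [hP_def, Matrix.add_apply, Matrix.smul_apply, onesMat, of_apply, smul_eq_mul, mul_one]
    linarith
  have hR (i j) : 0 ≤ R i j := by
    refine add_nonneg (hP i j) (mul_nonneg hlam0 ?_)
    rw [one_apply]
    split_ifs <;> norm_num
  have hg_trace (U V) : g U V =
      ((X - U * Vᵀ)ᵀ * (P * (X - U * Vᵀ))).trace + lam * ((U * Vᵀ)ᵀ * (U * Vᵀ)).trace := by
    rw [hg, frobSq_eq_trace, frobSq_eq_trace, sum_sq_colSum_eq_trace, hP_def, Matrix.add_mul,
      Matrix.mul_add, trace_add, Matrix.smul_mul, Matrix.mul_smul, trace_smul, smul_eq_mul,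
      transpose_mul A, Matrix.mul_assoc, Matrix.mul_assoc]
    ring
  have hNumU' : NumU = P * X * V := by
    simp only [hNumU, hP_def, Matrix.add_mul, Matrix.smul_mul]
  have hDenU' : DenU = R * U * (Vᵀ * V) := by
    simp only [hDenU, hR_def, hP_def, Matrix.add_mul, Matrix.smul_mul, Matrix.one_mul,
      Matrix.mul_assoc]
  have hNumV' : NumV = Xᵀ * P * U := by
    simp only [hNumV, hP_def, Matrix.add_mul, Matrix.mul_add, Matrix.smul_mul, Matrix.mul_smul,
      Matrix.mul_assoc]
  have hDenV' : DenV = (1 : Matrix (Fin n) (Fin n) ℝ) * V * (Uᵀ * R * U) := by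
    simp only [hDenV, hR_def, hP_def, Matrix.add_mul, Matrix.mul_add, Matrix.smul_mul,
      Matrix.mul_smul, Matrix.one_mul, Matrix.mul_assoc]
  have hUt (a i) : 0 ≤ Uᵀ a i := hU i a
  have hVt (a i) : 0 ≤ Vᵀ a i := hV i a
  refine ⟨fun hDen => ⟨fun i a => ?_, ?_⟩, fun hDen => ⟨fun i a => ?_, ?_⟩⟩
  · refine div_nonneg (mul_nonneg (hU i a) ?_) (hDen i a).le
    rw [hNumU']
    exact matrix_mul_nonneg (matrix_mul_nonneg hP hX) hV i a
  · set W : Matrix (Fin m) (Fin r) ℝ := of fun i a => U i a * NumU i a / DenU i a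
    have hstep := multiplicative_step_trace_increment_nonpos R (Vᵀ * V) hRs (by simp) hR
      (matrix_mul_nonneg hVt hV) U NumU (W - U) hU (by rwa [← hDenU'])
      (fun i a => by rw [← hDenU']; rfl)
    have hsplit : W * Vᵀ = U * Vᵀ + (W - U) * Vᵀ := by
      rw [← Matrix.add_mul, add_sub_cancel]
    have hlin : ((R * (U * Vᵀ) - P * X)ᵀ * ((W - U) * Vᵀ)).trace =
        ((R * U * (Vᵀ * V) - NumU)ᵀ * (W - U)).trace := by
      rw [← Matrix.mul_assoc, trace_mul_comm, ← Matrix.mul_assoc, ← transpose_mul,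
        Matrix.sub_mul, hNumU']
      simp only [Matrix.mul_assoc]
    have hquad : (((W - U) * Vᵀ)ᵀ * (R * ((W - U) * Vᵀ))).trace =
        ((W - U)ᵀ * (R * (W - U) * (Vᵀ * V))).trace := by
      rw [transpose_mul, transpose_transpose, Matrix.mul_assoc, trace_mul_comm]
      simp only [Matrix.mul_assoc]
    rw [hg_trace, hg_trace, hsplit, trace_quadratic_add P hPs, ← hR_def, hlin, hquad]
    linarith
  · refine div_nonneg (mul_nonneg (hV i a) ?_) (hDen i a).le
    rw [hNumV']
    exact matrix_mul_nonneg (matrix_mul_nonneg (fun i j => hX j i) hP) hU i a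
  · set W : Matrix (Fin n) (Fin r) ℝ := of fun i a => V i a * NumV i a / DenV i a
    have hstep := multiplicative_step_trace_increment_nonpos 1 (Uᵀ * R * U) transpose_one
      (by simp [hRs, Matrix.mul_assoc])
      (fun i j => by rw [one_apply]; split_ifs <;> norm_num)
      (matrix_mul_nonneg (matrix_mul_nonneg hUt hR) hU) V NumV (W - V) hV (by rwa [← hDenV'])
      (fun i a => by rw [← hDenV']; rfl)
    have hsplit : U * Wᵀ = U * Vᵀ + U * (W - V)ᵀ := by
      rw [← Matrix.mul_add, ← transpose_add, add_sub_cancel]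
    have hlin : ((R * (U * Vᵀ) - P * X)ᵀ * (U * (W - V)ᵀ)).trace =
        (((1 : Matrix (Fin n) (Fin n) ℝ) * V * (Uᵀ * R * U) - NumV)ᵀ * (W - V)).trace := by
      rw [← Matrix.mul_assoc, ← trace_transpose_mul, hNumV']
      simp only [transpose_sub, transpose_mul, transpose_transpose, hRs, hPs, Matrix.one_mul,
        Matrix.mul_assoc, Matrix.mul_sub, Matrix.sub_mul]
    have hquad : ((U * (W - V)ᵀ)ᵀ * (R * (U * (W - V)ᵀ))).trace =
        ((W - V)ᵀ * ((1 : Matrix (Fin n) (Fin n) ℝ) * (W - V) * (Uᵀ * R * U))).trace := by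
      rw [transpose_mul, transpose_transpose, Matrix.one_mul, trace_mul_comm (W - V)ᵀ]
      simp only [Matrix.mul_assoc]
    rw [hg_trace, hg_trace, hsplit, trace_quadratic_add P hPs, ← hR_def, hlin, hquad]
    linarith
end

section
/- Let X ∈ ℝ^{m×n} admit a factorization X = U₀V₀ᵀ where U₀ ∈ ℝ^{m×r} and V₀ ∈ ℝ^{n×r} both have rank r, with r ≤ min{m,n}. Let A₁ ∈ ℝ^{r×m} and A₂ ∈ ℝ^{n×r} be such that the r×r matrix A₁XA₂ is invertible. Then the r×r matrices A₁U₀ and V₀ᵀA₂ are invertible and X = XA₂(A₁XA₂)⁻¹A₁X. -/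
open Matrix

/-- Exact reconstruction of a rank-`r` matrix from its two-sided sketches:
if `X = U₀V₀ᵀ` with `U₀`, `V₀` of rank `r` and the core matrix `A₁XA₂` is
invertible, then `A₁U₀` and `V₀ᵀA₂` are invertible and
`X = XA₂ (A₁XA₂)⁻¹ A₁X`. -/
theorem two_sided_reconstruction_identity
    {m n r : ℕ} (hrm : r ≤ m) (hrn : r ≤ n)
    (X : Matrix (Fin m) (Fin n) ℝ)
    (U₀ : Matrix (Fin m) (Fin r) ℝ) (V₀ : Matrix (Fin n) (Fin r) ℝ)
    (hU₀rank : U₀.rank = r) (hV₀rank : V₀.rank = r)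
    (hfact : X = U₀ * V₀ᵀ)
    (A₁ : Matrix (Fin r) (Fin m) ℝ) (A₂ : Matrix (Fin n) (Fin r) ℝ)
    (hinv : IsUnit (A₁ * X * A₂)) :
    IsUnit (A₁ * U₀) ∧ IsUnit (V₀ᵀ * A₂) ∧
      X = X * A₂ * (A₁ * X * A₂)⁻¹ * (A₁ * X) := by
  subst hfact
  have hcore : A₁ * (U₀ * V₀ᵀ) * A₂ = (A₁ * U₀) * (V₀ᵀ * A₂) := by
    simp only [Matrix.mul_assoc]
  rw [hcore, Matrix.isUnit_iff_isUnit_det, Matrix.det_mul, IsUnit.mul_iff] at hinv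
  obtain ⟨hP, hQ⟩ := hinv
  refine ⟨(Matrix.isUnit_iff_isUnit_det _).2 hP, (Matrix.isUnit_iff_isUnit_det _).2 hQ, ?_⟩
  rw [hcore, Matrix.mul_inv_rev]
  calc U₀ * V₀ᵀ
      = U₀ * ((V₀ᵀ * A₂) * (V₀ᵀ * A₂)⁻¹) * ((A₁ * U₀)⁻¹ * (A₁ * U₀)) * V₀ᵀ := by
        rw [Matrix.mul_nonsing_inv _ hQ, Matrix.nonsing_inv_mul _ hP, Matrix.mul_one,
          Matrix.mul_one]
    _ = U₀ * V₀ᵀ * A₂ * ((V₀ᵀ * A₂)⁻¹ * (A₁ * U₀)⁻¹) * (A₁ * (U₀ * V₀ᵀ)) := by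
        simp only [Matrix.mul_assoc]
end

section
/- Let X ∈ ℝ^{m×n} admit a factorization X = U₀V₀ᵀ where U₀ ∈ ℝ^{m×r} and V₀ ∈ ℝ^{n×r} both have rank r, with r ≤ min{m,n}. Let A₁ ∈ ℝ^{r×m} and A₂ ∈ ℝ^{n×r} be such that A₁XA₂ is invertible. Then (A₁X)(A₁X)ᵀ and (XA₂)ᵀ(XA₂) are invertible, and with P₂ = (A₁X)ᵀ(A₁X(A₁X)ᵀ)⁻¹A₁X the orthogonal projection onto the row space of A₁X and P₁ = XA₂((XA₂)ᵀXA₂)⁻¹(XA₂)ᵀ the orthogonal projection onto the column space of XA₂, one has X(I_n − P₂) = 0 and (I_m − P₁)X = 0; that is, the row space of X is contained in the row space of A₁X and the column space of X is contained in the column space of XA₂. -/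
open Matrix

namespace Matrix

variable {k n p : Type*} [Fintype k] [DecidableEq k] [Fintype n]

/-- If `B * C` is invertible for some `C`, then so is the Gram matrix `B * Bᵀ` of the rows of `B`. -/
theorem isUnit_mul_transpose_self_of_isUnit_mul {B : Matrix k n ℝ} {C : Matrix n k ℝ}
    (h : IsUnit (B * C)) : IsUnit (B * Bᵀ) := by
  have hrank : (B * Bᵀ).rank = Fintype.card k := by
    refine le_antisymm (rank_le_card_width _) ?_
    rw [rank_self_mul_transpose, ← rank_of_isUnit _ h]
    exact rank_mul_le_left B C
  rw [← mulVec_surjective_iff_isUnit]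
  have hrange : LinearMap.range (B * Bᵀ).mulVecLin = ⊤ :=
    Submodule.eq_top_of_finrank_eq (by rwa [Module.finrank_fintype_fun_eq_card])
  exact LinearMap.range_eq_top.mp hrange

/-- If the rows of `X` are combinations of the rows of `B`, the orthogonal projection onto the
row space of `B` fixes `X`. -/
theorem mul_one_sub_row_projection_eq_zero [DecidableEq n] {X : Matrix p n ℝ} {B : Matrix k n ℝ}
    {Q : Matrix p k ℝ} (hX : X = Q * B) (hB : IsUnit (B * Bᵀ)) :
    X * (1 - Bᵀ * (B * Bᵀ)⁻¹ * B) = 0 := by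
  have h : B * Bᵀ * (B * Bᵀ)⁻¹ = 1 := mul_nonsing_inv _ ((isUnit_iff_isUnit_det _).mp hB)
  have hP : B * (Bᵀ * (B * Bᵀ)⁻¹ * B) = B := by
    rw [← Matrix.mul_assoc, ← Matrix.mul_assoc, h, Matrix.one_mul]
  rw [hX, Matrix.mul_assoc, Matrix.mul_sub B, hP, Matrix.mul_one, sub_self, Matrix.mul_zero]

/-- If the columns of `X` are combinations of the columns of `C`, the orthogonal projection onto
the column space of `C` fixes `X`. -/
theorem one_sub_column_projection_mul_eq_zero [DecidableEq n] {X : Matrix n p ℝ}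
    {C : Matrix n k ℝ} {Q : Matrix k p ℝ} (hX : X = C * Q) (hC : IsUnit (Cᵀ * C)) :
    (1 - C * (Cᵀ * C)⁻¹ * Cᵀ) * X = 0 := by
  have h : (Cᵀ * C)⁻¹ * (Cᵀ * C) = 1 := nonsing_inv_mul _ ((isUnit_iff_isUnit_det _).mp hC)
  have hP : C * (Cᵀ * C)⁻¹ * Cᵀ * C = C := by
    rw [Matrix.mul_assoc, Matrix.mul_assoc, h, Matrix.mul_one]
  rw [hX, ← Matrix.mul_assoc, Matrix.sub_mul, hP, Matrix.one_mul, sub_self, Matrix.zero_mul]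

end Matrix

/-- For a rank-`r` matrix `X` with invertible core `A₁XA₂`, the sketches
`A₁X` and `XA₂` capture the row space and column space of `X`:
`X(I − P₂) = 0` and `(I − P₁)X = 0` for the corresponding orthogonal
projections. -/
theorem sketches_capture_row_and_column_space
    {m n r : ℕ} (hrm : r ≤ m) (hrn : r ≤ n)
    (X : Matrix (Fin m) (Fin n) ℝ)
    (U₀ : Matrix (Fin m) (Fin r) ℝ) (V₀ : Matrix (Fin n) (Fin r) ℝ)
    (hU₀rank : U₀.rank = r) (hV₀rank : V₀.rank = r)
    (hfact : X = U₀ * V₀ᵀ)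
    (A₁ : Matrix (Fin r) (Fin m) ℝ) (A₂ : Matrix (Fin n) (Fin r) ℝ)
    (hinv : IsUnit (A₁ * X * A₂)) :
    IsUnit ((A₁ * X) * (A₁ * X)ᵀ) ∧ IsUnit ((X * A₂)ᵀ * (X * A₂)) ∧
      X * (1 - (A₁ * X)ᵀ * (A₁ * X * (A₁ * X)ᵀ)⁻¹ * (A₁ * X)) = 0 ∧
      (1 - X * A₂ * ((X * A₂)ᵀ * (X * A₂))⁻¹ * (X * A₂)ᵀ) * X = 0 := by
  have hcore : A₁ * X * A₂ = A₁ * U₀ * (V₀ᵀ * A₂) := by simp only [hfact, Matrix.mul_assoc]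
  have hdet : IsUnit ((A₁ * U₀).det * (V₀ᵀ * A₂).det) := by
    rwa [← det_mul, ← hcore, ← isUnit_iff_isUnit_det]
  have hU : (A₁ * U₀)⁻¹ * (A₁ * U₀) = 1 := nonsing_inv_mul _ (isUnit_of_mul_isUnit_left hdet)
  have hV : V₀ᵀ * A₂ * (V₀ᵀ * A₂)⁻¹ = 1 := mul_nonsing_inv _ (isUnit_of_mul_isUnit_right hdet)
  have hrow : X = U₀ * (A₁ * U₀)⁻¹ * (A₁ * X) := calc
    X = U₀ * ((A₁ * U₀)⁻¹ * (A₁ * U₀)) * V₀ᵀ := by rw [hU, Matrix.mul_one, hfact]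
    _ = U₀ * (A₁ * U₀)⁻¹ * (A₁ * X) := by simp only [hfact, Matrix.mul_assoc]
  have hcol : X = X * A₂ * ((V₀ᵀ * A₂)⁻¹ * V₀ᵀ) := calc
    X = U₀ * (V₀ᵀ * A₂ * (V₀ᵀ * A₂)⁻¹) * V₀ᵀ := by rw [hV, Matrix.mul_one, hfact]
    _ = X * A₂ * ((V₀ᵀ * A₂)⁻¹ * V₀ᵀ) := by simp only [hfact, Matrix.mul_assoc]
  have hB : IsUnit (A₁ * X * (A₁ * X)ᵀ) := isUnit_mul_transpose_self_of_isUnit_mul hinv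
  have hC : IsUnit ((X * A₂)ᵀ * (X * A₂)) := by
    have h : IsUnit ((X * A₂)ᵀ * A₁ᵀ) := by
      rwa [← transpose_mul, isUnit_transpose, ← Matrix.mul_assoc]
    simpa only [transpose_transpose] using isUnit_mul_transpose_self_of_isUnit_mul h
  exact ⟨hB, hC, mul_one_sub_row_projection_eq_zero hrow hB,
    one_sub_column_projection_mul_eq_zero hcol hC⟩
end

section
/- Let S ∈ ℝ^{q×q} be a symmetric matrix with all entries nonnegative, and let u ∈ ℝ^q have all entries positive. Let K be the q×q diagonal matrix with diagonal entries K_{ii} = (Su)_i / u_i. Then K − S is positive semidefinite, i.e., for every v ∈ ℝ^q, vᵀ(K − S)v ≥ 0. -/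
open Matrix

/-- The quadratic form of `diag((Su)/u) − S` as a weighted sum of squares. -/
theorem dotProduct_diag_ratio_sub_mulVec {n : Type*} [Fintype n] [DecidableEq n]
    (S : Matrix n n ℝ) (hS : S.IsSymm) (u : n → ℝ) (hu : ∀ i, u i ≠ 0) (v : n → ℝ) :
    v ⬝ᵥ (Matrix.diagonal (fun i => S.mulVec u i / u i) - S).mulVec v =
      1 / 2 * ∑ i, ∑ j, S i j * u i * u j * (v i / u i - v j / u j) ^ 2 := by
  have hform : v ⬝ᵥ (Matrix.diagonal (fun i => S.mulVec u i / u i) - S).mulVec v =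
      ∑ i, ∑ j, (S i j * u j * v i ^ 2 / u i - S i j * v i * v j) := by
    rw [Matrix.sub_mulVec, dotProduct]
    refine Finset.sum_congr rfl fun i _ => ?_
    rw [Pi.sub_apply, Matrix.mulVec_diagonal, Finset.sum_sub_distrib]
    simp only [Matrix.mulVec, dotProduct, mul_sub, Finset.sum_div, Finset.sum_mul,
      Finset.mul_sum]
    congr 1 <;> exact Finset.sum_congr rfl fun j _ => by ring
  have hswap : ∑ i, ∑ j, (S i j * u j * v i ^ 2 / u i - S i j * v i * v j) =
      ∑ i, ∑ j, (S i j * u i * v j ^ 2 / u j - S i j * v i * v j) := by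
    rw [Finset.sum_comm]
    refine Finset.sum_congr rfl fun i _ => Finset.sum_congr rfl fun j _ => ?_
    rw [hS.apply i j]
    ring
  have hsquares : ∑ i, ∑ j, S i j * u i * u j * (v i / u i - v j / u j) ^ 2 =
      ∑ i, ∑ j, (S i j * u j * v i ^ 2 / u i - S i j * v i * v j) +
        ∑ i, ∑ j, (S i j * u i * v j ^ 2 / u j - S i j * v i * v j) := by
    simp only [← Finset.sum_add_distrib]
    refine Finset.sum_congr rfl fun i _ => Finset.sum_congr rfl fun j _ => ?_
    have hi := hu i
    have hj := hu j
    field_simp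
    ring
  rw [hform, hsquares, ← hswap]
  ring

/-- The majorization lemma for multiplicative updates: if `S` is a symmetric
entrywise-nonnegative matrix and `u` is an entrywise-positive vector, then
`diag((Su)/u) − S` is positive semidefinite. -/
theorem diag_ratio_majorizes
    {q : ℕ} (S : Matrix (Fin q) (Fin q) ℝ)
    (hSsymm : Sᵀ = S) (hSnonneg : ∀ i j, 0 ≤ S i j)
    (u : Fin q → ℝ) (hu : ∀ i, 0 < u i) :
    (Matrix.diagonal (fun i => S.mulVec u i / u i) - S).PosSemidef := by
  refine .of_dotProduct_mulVec_nonneg ?_ fun v => ?_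
  · exact (isHermitian_diagonal _).sub (by rwa [IsHermitian, conjTranspose_eq_transpose_of_trivial])
  · rw [star_trivial, dotProduct_diag_ratio_sub_mulVec S hSsymm u fun i => (hu i).ne']
    refine mul_nonneg (by norm_num) (Finset.sum_nonneg fun i _ => Finset.sum_nonneg fun j _ => ?_)
    exact mul_nonneg (mul_nonneg (mul_nonneg (hSnonneg i j) (hu i).le) (hu j).le) (sq_nonneg _)
end

section
/- Let y ∈ ℝ^p, W ∈ ℝ^{p×q}, and u ∈ ℝ^q with all entries of u nonnegative. Suppose the matrix WᵀW has all entries nonnegative, the vector Wᵀy has all entries nonnegative, and the vector WᵀWu has all entries positive. Define u' ∈ ℝ^q by u'_i = u_i · (Wᵀy)_i / (WᵀWu)_i for each i. Then u' has all entries nonnegative and ‖y − Wu'‖² ≤ ‖y − Wu‖², where ‖·‖ is the Euclidean norm. -/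
open Matrix

/-- Expansion of the least-squares objective in terms of the Gram matrix and the correlation
vector. -/
theorem sum_sq_sub_mulVec {m n : Type*} [Fintype m] [Fintype n]
    (y : m → ℝ) (W : Matrix m n ℝ) (v : n → ℝ) :
    ∑ i, (y i - (W *ᵥ v) i) ^ 2 = y ⬝ᵥ y - 2 * (v ⬝ᵥ Wᵀ *ᵥ y) + v ⬝ᵥ (Wᵀ * W) *ᵥ v := by
  have hcorr : v ⬝ᵥ Wᵀ *ᵥ y = y ⬝ᵥ W *ᵥ v := by
    rw [mulVec_transpose, dotProduct_comm, dotProduct_mulVec]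
  have hgram : v ⬝ᵥ (Wᵀ * W) *ᵥ v = W *ᵥ v ⬝ᵥ W *ᵥ v := by
    rw [← mulVec_mulVec, dotProduct_mulVec, vecMul_transpose]
  rw [hcorr, hgram]
  simp only [dotProduct, Finset.mul_sum, ← Finset.sum_sub_distrib, ← Finset.sum_add_distrib]
  exact Finset.sum_congr rfl fun i _ => by ring

/-- For an entrywise nonnegative symmetric matrix `A` and a nonnegative vector `u`, the quadratic
form of `A` at `r * u` is bounded by a diagonal form in `r`. -/
theorem dotProduct_mulVec_mul_le {n : Type*} [Fintype n] {A : Matrix n n ℝ} (hA : A.IsSymm)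
    (hA0 : ∀ i j, 0 ≤ A i j) {u : n → ℝ} (hu : ∀ i, 0 ≤ u i) (r : n → ℝ) :
    (r * u) ⬝ᵥ A *ᵥ (r * u) ≤ ∑ i, r i ^ 2 * (u i * (A *ᵥ u) i) := by
  have hexpand : ∑ i, r i ^ 2 * (u i * (A *ᵥ u) i)
      = ∑ i, ∑ j, r i ^ 2 * (A i j * u i * u j) := by
    simp only [mulVec, dotProduct, Finset.mul_sum]
    exact Finset.sum_congr rfl fun i _ => Finset.sum_congr rfl fun j _ => by ring
  have hswap : ∑ i, ∑ j, r i ^ 2 * (A i j * u i * u j)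
      = ∑ i, ∑ j, r j ^ 2 * (A i j * u i * u j) := by
    rw [Finset.sum_comm]
    refine Finset.sum_congr rfl fun i _ => Finset.sum_congr rfl fun j _ => ?_
    rw [hA.apply i j]
    ring
  have hle : 2 * ((r * u) ⬝ᵥ A *ᵥ (r * u)) ≤ ∑ i, ∑ j, r i ^ 2 * (A i j * u i * u j)
      + ∑ i, ∑ j, r j ^ 2 * (A i j * u i * u j) := by
    simp only [mulVec, dotProduct, Finset.mul_sum, ← Finset.sum_add_distrib, Pi.mul_apply]
    refine Finset.sum_le_sum fun i _ => Finset.sum_le_sum fun j _ => ?_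
    have h := mul_nonneg (mul_nonneg (mul_nonneg (hA0 i j) (hu i)) (hu j))
      (sq_nonneg (r i - r j))
    linarith
  rw [hexpand]
  linarith

/-- The vectorized core of the multiplicative-updates descent argument:
if `WᵀW` and `Wᵀy` are entrywise nonnegative, `u` is entrywise nonnegative and
`WᵀWu` is entrywise positive, then the multiplicative update
`u ↦ u ∘ (Wᵀy)/(WᵀWu)` preserves nonnegativity and does not increase
`‖y − Wu‖²`. -/
theorem multiplicative_update_least_squares
    {p q : ℕ} (y : Fin p → ℝ) (W : Matrix (Fin p) (Fin q) ℝ)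
    (u : Fin q → ℝ) (hu : ∀ i, 0 ≤ u i)
    (hGram : ∀ i j, 0 ≤ (Wᵀ * W) i j)
    (hCorr : ∀ i, 0 ≤ Wᵀ.mulVec y i)
    (hDen : ∀ i, 0 < (Wᵀ * W).mulVec u i)
    (u' : Fin q → ℝ)
    (hu' : u' = fun i => u i * (Wᵀ.mulVec y i) / ((Wᵀ * W).mulVec u i)) :
    (∀ i, 0 ≤ u' i) ∧
      ∑ i, (y i - W.mulVec u' i) ^ 2 ≤ ∑ i, (y i - W.mulVec u i) ^ 2 := by
  have hu'_nonneg : ∀ i, 0 ≤ u' i := fun i => by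
    rw [hu']
    exact div_nonneg (mul_nonneg (hu i) (hCorr i)) (hDen i).le
  refine ⟨hu'_nonneg, ?_⟩
  set A := Wᵀ * W with hA
  set r : Fin q → ℝ := fun i => (Wᵀ *ᵥ y) i / (A *ᵥ u) i with hr
  have hru : u' = r * u := by
    rw [hu']
    ext i
    simp only [hr, Pi.mul_apply]
    ring
  have hcorr : ∀ i, (Wᵀ *ᵥ y) i = r i * (A *ᵥ u) i := fun i =>
    (div_mul_cancel₀ _ (hDen i).ne').symm
  have hsymm : A.IsSymm := by
    rw [hA, IsSymm, transpose_mul, transpose_transpose]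
  have hquad := dotProduct_mulVec_mul_le hsymm hGram hu r
  have hsq : 0 ≤ ∑ i, (r i - 1) ^ 2 * (u i * (A *ᵥ u) i) :=
    Finset.sum_nonneg fun i _ => mul_nonneg (sq_nonneg _) (mul_nonneg (hu i) (hDen i).le)
  have hident : ∑ i, (r i - 1) ^ 2 * (u i * (A *ᵥ u) i)
      = 2 * ((r * u) ⬝ᵥ Wᵀ *ᵥ y) - ∑ i, r i ^ 2 * (u i * (A *ᵥ u) i)
        - 2 * (u ⬝ᵥ Wᵀ *ᵥ y) + u ⬝ᵥ A *ᵥ u := by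
    simp only [dotProduct, hcorr, Finset.mul_sum, ← Finset.sum_sub_distrib,
      ← Finset.sum_add_distrib, Pi.mul_apply]
    exact Finset.sum_congr rfl fun i _ => by ring
  rw [sum_sq_sub_mulVec, sum_sq_sub_mulVec, ← hA, hru]
  linarith
end
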